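/- Let d ∈ ℕ, p ∈ (1,2] with p' an even integer, and let f : ℝ^d → ℂ be bounded with compact support. Set dμ = |f|^p dx, u(t,·) = H_t ∗ μ and q = p'. Then lim_{t → 0} Q_{p,q}(t) = ‖ (|f|)^∧ ‖_{L^{p'}(ℝ^d)} and lim_{t → ∞} Q_{p,q}(t) = ‖ (H_1^{1/p})^∧ ‖_{L^{p'}(ℝ^d)} · ‖f‖_{L^p(ℝ^d)}; consequently, since Q_{p,p'} is nondecreasing and ‖f̂‖_{p'} ≤ ‖(|f|)^∧‖_{p'} for p' an even integer, one recovers the sharp Hausdorff–Young inequality ‖f̂‖_{L^{p'}(ℝ^d)} ≤ (p^{1/p}/p'^{1/p'})^{d/2} ‖f‖_{L^p(ℝ^d)}. -/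

import Mathlib

open MeasureTheory Real Filter
open scoped FourierTransform ENNReal Topology

/-- The heat kernel `H_t(x) = t^{-d/2} e^{-π|x|²/t}` on `ℝ^d`. -/
noncomputable def heatKernel (d : ℕ) (t : ℝ) (x : EuclideanSpace ℝ (Fin d)) : ℝ :=
  t ^ (-(d : ℝ) / 2) * Real.exp (-π * ‖x‖ ^ 2 / t)

/-- The solution `u(t,·) = H_t ∗ μ` of the heat equation with initial datum `μ`. -/
noncomputable def heatEvolution (d : ℕ) (μ : Measure (EuclideanSpace ℝ (Fin d)))
    (t : ℝ) (x : EuclideanSpace ℝ (Fin d)) : ℝ :=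
  ∫ y, heatKernel d t (x - y) ∂μ

/-- `Q_{p,q}(t) = t^{(d/2)(1/q - 1/p')} ‖(u(t,·)^{1/p})^∧‖_{L^q(ℝ^d)}`, where `1/p' = 1 - 1/p`. -/
noncomputable def Q (d : ℕ) (μ : Measure (EuclideanSpace ℝ (Fin d))) (p q t : ℝ) : ℝ :=
  t ^ ((d : ℝ) / 2 * (1 / q - (1 - 1 / p))) *
    (eLpNorm (𝓕 fun x => ((heatEvolution d μ t x ^ (1 / p) : ℝ) : ℂ))
      (ENNReal.ofReal q) volume).toReal

/-- The Gaussian distribution function has a smooth strictly increasing inverse on `(0, 1)`. -/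
theorem exists_gaussian_quantile :
    ∃ r : ℝ → ℝ, StrictMonoOn r (Set.Ioo 0 1) ∧
      ∀ y ∈ Set.Ioo (0 : ℝ) 1, HasDerivAt r (Real.exp (-π * r y ^ 2))⁻¹ y := by
  have hint : Integrable fun x : ℝ => Real.exp (-π * x ^ 2) := integrable_exp_neg_mul_sq pi_pos
  have hmass : ∫ x : ℝ, Real.exp (-π * x ^ 2) = 1 := by
    rw [integral_gaussian, div_self pi_ne_zero, Real.sqrt_one]
  have hcont : Continuous fun x : ℝ => Real.exp (-π * x ^ 2) := by fun_prop
  set G : ℝ → ℝ := fun x => ∫ s in Set.Iic x, Real.exp (-π * s ^ 2) with hG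
  have hderiv : ∀ x, HasDerivAt G (Real.exp (-π * x ^ 2)) x := by
    intro x
    have h1 : G = fun x => G 0 + ∫ s in (0 : ℝ)..x, Real.exp (-π * s ^ 2) := by
      ext x
      rw [← intervalIntegral.integral_Iic_sub_Iic hint.integrableOn hint.integrableOn]
      simp [hG]
    rw [h1]
    exact (intervalIntegral.integral_hasDerivAt_right hint.intervalIntegrable
      (hcont.stronglyMeasurableAtFilter _ _) hcont.continuousAt).const_add _
  have hmono : StrictMono G := strictMono_of_deriv_pos fun x => by
    rw [(hderiv x).deriv]; positivity
  have htop : Tendsto G atTop (𝓝 1) := by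
    have := (aecover_Iic (μ := (volume : Measure ℝ)) tendsto_id).integral_tendsto_of_countably_generated
      hint
    rw [hmass] at this
    exact this
  have hbot : Tendsto G atBot (𝓝 0) := by
    have h2 := (aecover_Ioi (μ := (volume : Measure ℝ)) (a := fun x : ℝ => x)
      (l := atBot) tendsto_id).integral_tendsto_of_countably_generated hint
    rw [hmass] at h2
    have h3 : G = fun x => 1 - ∫ s in Set.Ioi x, Real.exp (-π * s ^ 2) := by
      ext x
      rw [← hmass, ← intervalIntegral.integral_Iic_add_Ioi hint.integrableOn hint.integrableOn
        (b := x)]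
      simp [hG]
    rw [h3]
    simpa using h2.const_sub 1
  have hG0 : ∀ x, 0 < G x := fun x =>
    (hmono.monotone.le_of_tendsto hbot (x - 1)).trans_lt (hmono (by linarith))
  have hG1 : ∀ x, G x < 1 := fun x =>
    (hmono (by linarith : x < x + 1)).trans_le (hmono.monotone.ge_of_tendsto htop (x + 1))
  have hGc : Continuous G := continuous_iff_continuousAt.2 fun x => (hderiv x).continuousAt
  have hsurj : ∀ y ∈ Set.Ioo (0 : ℝ) 1, ∃ x, G x = y := by
    intro y hy
    obtain ⟨a, ha⟩ := (hbot.eventually_lt_const hy.1).exists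
    obtain ⟨b, hb⟩ := (htop.eventually_const_lt hy.2).exists
    exact mem_range_of_exists_le_of_exists_ge hGc ⟨a, ha.le⟩ ⟨b, hb.le⟩
  set r := Function.invFun G with hr
  have hGr : ∀ y ∈ Set.Ioo (0 : ℝ) 1, G (r y) = y := fun y hy => Function.invFun_eq (hsurj y hy)
  have hrmono : StrictMonoOn r (Set.Ioo 0 1) := by
    intro a ha b hb hab
    rw [← hmono.lt_iff_lt, hGr a ha, hGr b hb]
    exact hab
  refine ⟨r, hrmono, fun y hy => ?_⟩
  have hnhds : Set.Ioo (0 : ℝ) 1 ∈ 𝓝 y := Ioo_mem_nhds hy.1 hy.2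
  refine HasDerivAt.of_local_left_inverse ?_ (hderiv _) (Real.exp_pos _).ne' ?_
  · refine hrmono.continuousAt_of_image_mem_nhds hnhds ?_
    have : r '' Set.Ioo 0 1 = Set.univ := by
      refine Set.eq_univ_of_forall fun x => ⟨G x, ⟨hG0 x, hG1 x⟩, ?_⟩
      exact Function.leftInverse_invFun hmono.injective x
    rw [this]; exact univ_mem
  · filter_upwards [hnhds] with z hz using hGr z hz

/-- Monotone transport of a probability density on the line to the Gaussian density. -/
theorem exists_transport_gaussian {f : ℝ → ℝ≥0∞} (hf : Measurable f) (hf1 : ∫⁻ x, f x = 1) :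
    ∃ (T a : ℝ → ℝ) (S : Set ℝ), MeasurableSet S ∧ (∀ᵐ x, f x ≠ 0 → x ∈ S) ∧
      StrictMonoOn T S ∧ ∀ x ∈ S, 0 < a x ∧ HasDerivAt T (a x) x ∧
        f x = ENNReal.ofReal (a x * Real.exp (-π * T x ^ 2)) := by
  obtain ⟨r, hrmono, hr⟩ := exists_gaussian_quantile
  set μ : Measure ℝ := volume.withDensity f with hμ
  have : IsProbabilityMeasure μ := ⟨by simp [hμ, hf1]⟩
  set F := ProbabilityTheory.cdf μ with hF
  have hder : ∀ᵐ x, HasDerivAt F (f x).toReal x := by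
    have h2 := Measure.rnDeriv_withDensity volume hf
    filter_upwards [F.ae_hasDerivAt, h2] with x hx hx2
    rw [hF, ProbabilityTheory.measure_cdf] at hx
    rwa [← hx2]
  have hfin : ∀ᵐ x, f x < ∞ := ae_lt_top hf (by simp [hf1])
  obtain ⟨D, hDnull, hDm, hDsub⟩ := (hder.and hfin).exists_measurable_mem
  have hstrict : ∀ x ∈ D, f x ≠ 0 → ∀ y, (x < y → F x < F y) ∧ (y < x → F y < F x) := by
    intro x hx hx0 y
    obtain ⟨hd, hlt⟩ := hDsub x hx
    have hpos : 0 < (f x).toReal := ENNReal.toReal_pos hx0 hlt.ne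
    constructor
    · intro hxy
      refine (F.mono hxy.le).lt_of_ne fun heq => hpos.ne' ?_
      have h0 : HasDerivWithinAt F 0 (Set.Icc x y) x := by
        refine (hasDerivWithinAt_const x _ (F x)).congr (fun z hz => ?_) rfl
        exact le_antisymm (heq ▸ F.mono hz.2) (F.mono hz.1)
      exact (uniqueDiffOn_Icc hxy x ⟨le_rfl, hxy.le⟩).eq_deriv _ hd.hasDerivWithinAt h0
    · intro hxy
      refine (F.mono hxy.le).lt_of_ne fun heq => hpos.ne' ?_
      have h0 : HasDerivWithinAt F 0 (Set.Icc y x) x := by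
        refine (hasDerivWithinAt_const x _ (F x)).congr (fun z hz => ?_) rfl
        exact le_antisymm (F.mono hz.2) (heq ▸ F.mono hz.1)
      exact (uniqueDiffOn_Icc hxy x ⟨hxy.le, le_rfl⟩).eq_deriv _ hd.hasDerivWithinAt h0
  have hIoo : ∀ x ∈ D, f x ≠ 0 → F x ∈ Set.Ioo (0 : ℝ) 1 := fun x hx hx0 =>
    ⟨(ProbabilityTheory.cdf_nonneg μ (x - 1)).trans_lt ((hstrict x hx hx0 _).2 (by linarith)),
      ((hstrict x hx hx0 (x + 1)).1 (by linarith)).trans_le (ProbabilityTheory.cdf_le_one μ _)⟩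
  refine ⟨fun x => r (F x), fun x => (Real.exp (-π * r (F x) ^ 2))⁻¹ * (f x).toReal,
    D ∩ {x | f x ≠ 0}, hDm.inter (hf (measurableSet_singleton 0).compl), ?_, ?_, ?_⟩
  · filter_upwards [hDnull] with x hx h0 using ⟨hx, h0⟩
  · intro x hx y hy hxy
    exact hrmono (hIoo x hx.1 hx.2) (hIoo y hy.1 hy.2) ((hstrict x hx.1 hx.2 y).1 hxy)
  · rintro x ⟨hx, hx0⟩
    obtain ⟨hd, hlt⟩ := hDsub x hx
    have hpos : 0 < (f x).toReal := ENNReal.toReal_pos hx0 hlt.ne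
    refine ⟨by positivity, (hr _ (hIoo x hx hx0)).comp x hd, ?_⟩
    rw [mul_right_comm, inv_mul_cancel₀ (Real.exp_pos _).ne', one_mul, ENNReal.ofReal_toReal hlt.ne]

/-- The exponent `1 / p` for which `n + 1` functions in `L^p` convolve boundedly at the origin. -/
noncomputable def conjExp (n : ℕ) : ℝ := n / (n + 1)

/-- The sharp one-dimensional constant in the convolution inequality for `n + 1` functions. -/
noncomputable def convConst (n : ℕ) : ℝ :=
  (√(n + 1))⁻¹ * (√(conjExp n)⁻¹) ^ n

theorem conjExp_pos {n : ℕ} (hn : 0 < n) : 0 < conjExp n := by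
  unfold conjExp; positivity

theorem convConst_pos {n : ℕ} (hn : 0 < n) : 0 < convConst n := by
  have := conjExp_pos hn
  unfold convConst; positivity

theorem lintegral_gaussian {b : ℝ} (hb : 0 < b) :
    ∫⁻ x : ℝ, ENNReal.ofReal (Real.exp (-b * x ^ 2)) = ENNReal.ofReal √(π / b) := by
  rw [← integral_gaussian, ofReal_integral_eq_lintegral_ofReal (integrable_exp_neg_mul_sq hb)
    (ae_of_all _ fun x => (Real.exp_pos _).le)]

theorem lintegral_gaussian_pi {ι : Type*} [Fintype ι] {b : ℝ} (hb : 0 < b) :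
    ∫⁻ x : ι → ℝ, ENNReal.ofReal (Real.exp (-b * ∑ i, x i ^ 2)) =
      ENNReal.ofReal √(π / b) ^ Fintype.card ι := by
  have h1 : ∀ x : ι → ℝ, Real.exp (-b * ∑ i, x i ^ 2) = ∏ i, Real.exp (-b * x i ^ 2) := by
    intro x
    rw [← Real.exp_sum, Finset.mul_sum]
  have hI : Integrable fun x : ι → ℝ => ∏ i, Real.exp (-b * x i ^ 2) :=
    Integrable.fintype_prod fun _ => integrable_exp_neg_mul_sq hb
  simp_rw [h1]
  rw [← ofReal_integral_eq_lintegral_ofReal hI (ae_of_all _ fun x => by positivity),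
    integral_fintype_prod_volume_eq_prod (f := fun _ x => Real.exp (-b * x ^ 2))]
  simp_rw [integral_gaussian]
  rw [Finset.prod_const, Finset.card_univ, ENNReal.ofReal_pow (Real.sqrt_nonneg _)]

/-- The Gaussian integral of the quadratic form dual to `∑ x i ^ 2 + (∑ x i) ^ 2`. -/
theorem lintegral_gaussian_dual {ι : Type*} [Fintype ι] {c : ℝ} (hc : 0 < c) :
    ∫⁻ y : ι → ℝ, ENNReal.ofReal
        (Real.exp (-(π * c) * (∑ i, y i ^ 2 - (∑ i, y i) ^ 2 / (Fintype.card ι + 1)))) =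
      ENNReal.ofReal (√(Fintype.card ι + 1) * (√c⁻¹) ^ Fintype.card ι) := by
  set N : ℝ := Fintype.card ι + 1 with hN
  have hN0 : 0 < N := by positivity
  have hpc : 0 < π * c := by positivity
  have hpcN : 0 < π * c * N := by positivity
  set q : (ι → ℝ) → ℝ := fun y => ∑ i, y i ^ 2 - (∑ i, y i) ^ 2 / N with hq
  have key : ∀ (y : ι → ℝ) (s : ℝ),
      Real.exp (-(π * c) * q y) * Real.exp (-(π * c * N) * (s + (∑ i, y i) / N) ^ 2) =
        Real.exp (-(π * c) * ∑ i, (y i + s) ^ 2) * Real.exp (-(π * c) * s ^ 2) := by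
    intro y s
    rw [← Real.exp_add, ← Real.exp_add]
    congr 1
    have h : ∑ i, (y i + s) ^ 2 = ∑ i, y i ^ 2 + 2 * s * ∑ i, y i + (N - 1) * s ^ 2 := by
      simp_rw [add_sq, Finset.sum_add_distrib, Finset.mul_sum]
      simp [hN, mul_comm, mul_left_comm]
    rw [h, hq]
    field_simp
    ring
  have e1 : ∫⁻ y : ι → ℝ, ∫⁻ s : ℝ, ENNReal.ofReal (Real.exp (-(π * c) * q y) *
      Real.exp (-(π * c * N) * (s + (∑ i, y i) / N) ^ 2)) =
      (∫⁻ y, ENNReal.ofReal (Real.exp (-(π * c) * q y))) * ENNReal.ofReal √(π / (π * c * N)) := by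
    rw [← lintegral_mul_const']
    · refine lintegral_congr fun y => ?_
      simp_rw [ENNReal.ofReal_mul (Real.exp_pos (-(π * c) * q y)).le]
      rw [lintegral_const_mul' _ _ ENNReal.ofReal_ne_top, ← lintegral_gaussian hpcN]
      congr 1
      exact lintegral_add_right_eq_self (μ := volume)
        (fun s => ENNReal.ofReal (Real.exp (-(π * c * N) * s ^ 2))) _
    · exact ENNReal.ofReal_ne_top
  have e2 : ∫⁻ y : ι → ℝ, ∫⁻ s : ℝ, ENNReal.ofReal (Real.exp (-(π * c) * q y) *
      Real.exp (-(π * c * N) * (s + (∑ i, y i) / N) ^ 2)) =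
      ENNReal.ofReal √(π / (π * c)) ^ Fintype.card ι * ENNReal.ofReal √(π / (π * c)) := by
    rw [lintegral_lintegral_swap (by fun_prop)]
    simp_rw [key, ENNReal.ofReal_mul (Real.exp_pos _).le]
    rw [← lintegral_gaussian_pi hpc, ← lintegral_gaussian hpc, ← lintegral_const_mul _ (by fun_prop)]
    refine lintegral_congr fun s => ?_
    rw [lintegral_mul_const _ (by fun_prop)]
    congr 1
    exact lintegral_add_right_eq_self (μ := volume)
      (fun y : ι → ℝ => ENNReal.ofReal (Real.exp (-(π * c) * ∑ i, y i ^ 2))) (fun _ => s)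
  rw [e1] at e2
  have h3 : 0 < √(π / (π * c * N)) := by positivity
  have h4 : π / (π * c) = c⁻¹ := by field_simp
  have h5 : √(π / (π * c * N)) * √N = √c⁻¹ := by
    rw [← Real.sqrt_mul (by positivity)]
    congr 1
    field_simp
  refine (ENNReal.mul_left_inj (by simpa using h3) ENNReal.ofReal_ne_top).1 (e2.trans ?_)
  rw [h4, ← ENNReal.ofReal_pow (by positivity), ← ENNReal.ofReal_mul (by positivity),
    ← ENNReal.ofReal_mul (by positivity)]
  congr 1
  rw [← h5]
  ring

theorem det_diagonal_add_const {ι : Type*} [Fintype ι] [DecidableEq ι] {a : ι → ℝ}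
    (ha : ∀ i, a i ≠ 0) (b : ℝ) :
    (Matrix.diagonal a + Matrix.of fun _ _ => b).det = (∏ i, a i) * (1 + b * ∑ i, (a i)⁻¹) := by
  have h : Matrix.diagonal a + Matrix.of (fun _ _ => b) = Matrix.diagonal a *
      (1 + Matrix.replicateCol Unit (fun i => (a i)⁻¹) * Matrix.replicateRow Unit (fun _ => b)) := by
    ext i j
    rw [mul_add, mul_one, Matrix.add_apply, Matrix.add_apply, Matrix.diagonal_mul]
    simp [Matrix.mul_apply, ha i]
  rw [h, Matrix.det_mul, Matrix.det_diagonal, Matrix.det_one_add_replicateCol_mul_replicateRow]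
  simp [dotProduct, Finset.mul_sum]

theorem prod_rpow_le_det {ι : Type*} [Fintype ι] {a : ι → ℝ} {b : ℝ}
    (ha : ∀ i, 0 < a i) (hb : 0 < b) :
    (Fintype.card ι + 1) * ((∏ i, a i ^ conjExp (Fintype.card ι)) * b ^ conjExp (Fintype.card ι)) ≤
      (∏ i, a i) * (1 + b * ∑ i, (a i)⁻¹) := by
  set N : ℝ := Fintype.card ι + 1 with hN
  have hN0 : 0 < N := by positivity
  have hc : conjExp (Fintype.card ι) = 1 + -N⁻¹ := by
    rw [conjExp, ← hN]; field_simp; rw [hN]; ring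
  have amgm := Real.geom_mean_le_arith_mean_weighted (Finset.univ : Finset (Option ι))
    (fun _ => N⁻¹) (fun o => (o.elim b a)⁻¹) (fun _ _ => by positivity)
    (by simp [hN]; field_simp) (fun o _ => by cases o <;> simp [hb.le, (ha _).le])
  rw [Fintype.prod_option, Fintype.sum_option] at amgm
  simp only [Option.elim] at amgm
  have hpow : ∀ x : ℝ, 0 < x → x ^ conjExp (Fintype.card ι) = x * x⁻¹ ^ N⁻¹ := by
    intro x hx
    rw [hc, Real.rpow_add hx, Real.rpow_one, Real.rpow_neg hx.le, Real.inv_rpow hx.le]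
  simp_rw [fun i => hpow _ (ha i), hpow b hb, Finset.prod_mul_distrib]
  have hP : 0 < (∏ i, a i) * b := mul_pos (Finset.prod_pos fun i _ => ha i) hb
  calc N * ((∏ i, a i) * (∏ i, (a i)⁻¹ ^ N⁻¹) * (b * b⁻¹ ^ N⁻¹))
      = ((∏ i, a i) * b) * N * (b⁻¹ ^ N⁻¹ * ∏ i, (a i)⁻¹ ^ N⁻¹) := by ring
    _ ≤ ((∏ i, a i) * b) * N * (N⁻¹ * b⁻¹ + ∑ i, N⁻¹ * (a i)⁻¹) := by gcongr
    _ = (∏ i, a i) * (1 + b * ∑ i, (a i)⁻¹) := by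
      rw [← Finset.mul_sum]; field_simp

theorem dual_form_le {ι : Type*} [Fintype ι] (y : ι → ℝ) (s : ℝ) :
    ∑ i, (y i - s) ^ 2 - (∑ i, (y i - s)) ^ 2 / (Fintype.card ι + 1) ≤ ∑ i, y i ^ 2 + s ^ 2 := by
  set N : ℝ := Fintype.card ι + 1 with hN
  have hN0 : 0 < N := by positivity
  have h : ∑ i, y i ^ 2 + s ^ 2 = ∑ i, (y i - s) ^ 2 + 2 * s * ∑ i, (y i - s) + N * s ^ 2 := by
    have : ∀ i, y i ^ 2 = (y i - s) ^ 2 + 2 * s * (y i - s) + s ^ 2 := fun i => by ring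
    simp_rw [this, Finset.sum_add_distrib, Finset.mul_sum]
    simp [hN]; ring
  rw [h]
  set Y := ∑ i, (y i - s)
  have : 0 ≤ N * (s + Y / N) ^ 2 := by positivity
  have h2 : N * (s + Y / N) ^ 2 = N * s ^ 2 + 2 * s * Y + Y ^ 2 / N := by field_simp; ring
  linarith

theorem ae_neg_sum_mem {ι : Type*} [Fintype ι] [Nonempty ι] {S : ℝ → Prop} (hS : ∀ᵐ s, S s) :
    ∀ᵐ x : ι → ℝ, S (-∑ i, x i) := by
  obtain ⟨D, hD, hDm, hDS⟩ := hS.exists_measurable_mem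
  let L : (ι → ℝ) →ₗ[ℝ] ℝ := -∑ i, LinearMap.proj i
  have hL : ∀ x, L x = -∑ i, x i := fun x => by simp [L]
  have hsurj : Function.Surjective L := by
    classical
    intro s
    obtain ⟨i⟩ := ‹Nonempty ι›
    exact ⟨Pi.single i (-s), by rw [hL, Finset.sum_pi_single']; simp⟩
  filter_upwards [(ae_comp_linearMap_mem_iff L volume volume hsurj hDm).2 hD] with x hx
  rw [← hL]
  exact hDS _ hx

theorem ae_pi_eval_mem {ι : Type*} [Fintype ι] (i : ι) {S : ℝ → Prop} (hS : ∀ᵐ s, S s) :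
    ∀ᵐ x : ι → ℝ, S (x i) :=
  (Measure.quasiMeasurePreserving_eval (μ := fun _ : ι => (volume : Measure ℝ)) i).ae hS

/-- The sharp convolution inequality at the origin on the line, for probability densities. -/
theorem lintegral_prod_rpow_le_of_density {ι : Type*} [Fintype ι] [Nonempty ι]
    {f : ι → ℝ → ℝ≥0∞} {g : ℝ → ℝ≥0∞} (hf : ∀ i, Measurable (f i)) (hg : Measurable g)
    (hf1 : ∀ i, ∫⁻ x, f i x = 1) (hg1 : ∫⁻ x, g x = 1) :
    ∫⁻ x : ι → ℝ, (∏ i, f i (x i) ^ conjExp (Fintype.card ι)) *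
        g (-∑ i, x i) ^ conjExp (Fintype.card ι) ≤
      ENNReal.ofReal (convConst (Fintype.card ι)) := by
  classical
  set c := conjExp (Fintype.card ι) with hc
  have hc0 : 0 < c := conjExp_pos Fintype.card_pos
  set N : ℝ := Fintype.card ι + 1 with hN
  have hN0 : 0 < N := by positivity
  choose T a S hSm hSae hTmono hTa using fun i => exists_transport_gaussian (hf i) (hf1 i)
  obtain ⟨T', a', S', hSm', hSae', hTmono', hTa'⟩ := exists_transport_gaussian hg hg1
  set A : Set (ι → ℝ) := {x | (∀ i, x i ∈ S i) ∧ -∑ i, x i ∈ S'} with hA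
  have hAm : MeasurableSet A := by
    refine MeasurableSet.inter (s₁ := {x : ι → ℝ | ∀ i, x i ∈ S i}) ?_ ?_
    · simp only [Set.ofPred_forall]
      exact MeasurableSet.iInter fun i => measurable_pi_apply i (hSm i)
    · exact (show Measurable fun x : ι → ℝ => -∑ i, x i by fun_prop) hSm'
  set Φ : (ι → ℝ) → ι → ℝ := fun x i => T i (x i) - T' (-∑ j, x j) with hΦ
  set M : (ι → ℝ) → Matrix ι ι ℝ := fun x =>
    Matrix.diagonal (fun i => a i (x i)) + Matrix.of fun _ _ => a' (-∑ j, x j) with hM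
  set Φ' : (ι → ℝ) → (ι → ℝ) →L[ℝ] (ι → ℝ) := fun x =>
    LinearMap.toContinuousLinearMap (Matrix.toLin' (M x)) with hΦ'
  have hdet : ∀ x, (Φ' x).det = (M x).det := fun x => by
    simp [hΦ', ContinuousLinearMap.det]
  have hderiv : ∀ x ∈ A, HasFDerivWithinAt Φ (Φ' x) A x := by
    intro x hx
    refine HasFDerivAt.hasFDerivWithinAt ?_
    rw [hasFDerivAt_pi']
    intro i
    have h1 : HasFDerivAt (fun x : ι → ℝ => T i (x i))
        ((a i (x i)) • (ContinuousLinearMap.proj i : (ι → ℝ) →L[ℝ] ℝ)) x :=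
      (hTa i (x i) (hx.1 i)).2.1.comp_hasFDerivAt x (hasFDerivAt_apply i x)
    have h2 : HasFDerivAt (fun x : ι → ℝ => -∑ j, x j)
        (-∑ j, (ContinuousLinearMap.proj j : (ι → ℝ) →L[ℝ] ℝ)) x :=
      (HasFDerivAt.fun_sum fun j _ => hasFDerivAt_apply j x).neg
    have h3 := (hTa' (-∑ j, x j) hx.2).2.1.comp_hasFDerivAt x h2
    refine (h1.sub h3).congr_fderiv ?_
    ext v
    simp [hΦ', hM, Matrix.toLin'_apply, Matrix.mulVec, dotProduct, Matrix.diagonal_apply, Finset.mul_sum]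
  have hinj : Set.InjOn Φ A := by
    intro x hx y hy hxy
    have hi : ∀ i, T i (x i) - T i (y i) = T' (-∑ j, x j) - T' (-∑ j, y j) := fun i => by
      have := congrFun hxy i
      simp only [hΦ] at this
      linarith
    rcases lt_trichotomy (T' (-∑ j, x j)) (T' (-∑ j, y j)) with h | h | h
    · have h1 : ∀ i, x i < y i := fun i =>
        ((hTmono i).lt_iff_lt (hx.1 i) (hy.1 i)).1 (by linarith [hi i])
      have h2 := (hTmono'.lt_iff_lt hx.2 hy.2).1 h
      have h3 : ∑ j, x j < ∑ j, y j := Finset.sum_lt_sum_of_nonempty Finset.univ_nonempty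
        fun i _ => h1 i
      linarith
    · ext i
      exact (hTmono i).injOn (hx.1 i) (hy.1 i) (by linarith [hi i])
    · have h1 : ∀ i, y i < x i := fun i =>
        ((hTmono i).lt_iff_lt (hy.1 i) (hx.1 i)).1 (by linarith [hi i])
      have h2 := (hTmono'.lt_iff_lt hy.2 hx.2).1 h
      have h3 : ∑ j, y j < ∑ j, x j := Finset.sum_lt_sum_of_nonempty Finset.univ_nonempty
        fun i _ => h1 i
      linarith
  set γ : (ι → ℝ) → ℝ≥0∞ := fun y => ENNReal.ofReal
    (Real.exp (-(π * c) * (∑ i, y i ^ 2 - (∑ i, y i) ^ 2 / (Fintype.card ι + 1)))) with hγ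
  have hpt : ∀ x ∈ A, (∏ i, f i (x i) ^ c) * g (-∑ i, x i) ^ c ≤
      ENNReal.ofReal N⁻¹ * (ENNReal.ofReal |(Φ' x).det| * γ (Φ x)) := by
    intro x hx
    have ha : ∀ i, 0 < a i (x i) := fun i => (hTa i _ (hx.1 i)).1
    have ha' : 0 < a' (-∑ i, x i) := (hTa' _ hx.2).1
    have hpow : ∀ u v : ℝ, 0 < u → ENNReal.ofReal (u * Real.exp (-π * v ^ 2)) ^ c =
        ENNReal.ofReal (u ^ c * Real.exp (-(π * c) * v ^ 2)) := by
      intro u v hu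
      rw [ENNReal.ofReal_rpow_of_pos (by positivity), Real.mul_rpow hu.le (Real.exp_pos _).le,
        ← Real.exp_mul]
      congr 3
      ring
    simp_rw [fun i => (hTa i _ (hx.1 i)).2.2, (hTa' _ hx.2).2.2, fun i => hpow _ (T i (x i)) (ha i),
      hpow _ (T' (-∑ i, x i)) ha']
    rw [← ENNReal.ofReal_prod_of_nonneg (fun i _ => by have := ha i; positivity),
      ← ENNReal.ofReal_mul (Finset.prod_nonneg fun i _ => by have := ha i; positivity),
      hγ, ← ENNReal.ofReal_mul (abs_nonneg _), ← ENNReal.ofReal_mul (by positivity)]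
    refine ENNReal.ofReal_le_ofReal ?_
    rw [hdet, hM, det_diagonal_add_const (fun i => (ha i).ne'), Finset.prod_mul_distrib,
      ← Real.exp_sum]
    have h1 := prod_rpow_le_det ha ha'
    rw [← hN, ← hc] at h1
    set D := (∏ i, a i (x i)) * (1 + a' (-∑ i, x i) * ∑ i, (a i (x i))⁻¹) with hD
    have h2 := dual_form_le (fun i => T i (x i)) (T' (-∑ i, x i))
    set P := ∏ i, a i (x i) ^ c
    set q := ∑ i, (T i (x i) - T' (-∑ i, x i)) ^ 2 -
      (∑ i, (T i (x i) - T' (-∑ i, x i))) ^ 2 / (Fintype.card ι + 1) with hq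
    calc (P * Real.exp (∑ i, -(π * c) * T i (x i) ^ 2)) *
          (a' (-∑ i, x i) ^ c * Real.exp (-(π * c) * T' (-∑ i, x i) ^ 2))
        = N⁻¹ * (N * (P * a' (-∑ i, x i) ^ c)) *
          Real.exp (-(π * c) * (∑ i, T i (x i) ^ 2 + T' (-∑ i, x i) ^ 2)) := by
          rw [mul_add, Real.exp_add, ← Finset.mul_sum]
          field_simp
      _ ≤ N⁻¹ * |D| * Real.exp (-(π * c) * q) := by
          have h3 : -(π * c) * (∑ i, T i (x i) ^ 2 + T' (-∑ i, x i) ^ 2) ≤ -(π * c) * q :=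
            mul_le_mul_of_nonpos_left h2 (by have := mul_pos pi_pos hc0; linarith)
          gcongr
          exact h1.trans (le_abs_self D)
      _ = N⁻¹ * (|D| * Real.exp (-(π * c) * q)) := by ring
  have hzero : ∀ᵐ x : ι → ℝ, x ∉ A →
      (∏ i, f i (x i) ^ c) * g (-∑ i, x i) ^ c = 0 := by
    filter_upwards [ae_all_iff.2 fun i => ae_pi_eval_mem i (hSae i), ae_neg_sum_mem hSae']
      with x h1 h2 hxA
    by_contra h0
    obtain ⟨h3, h4⟩ := mul_ne_zero_iff.1 h0
    refine hxA ⟨fun i => h1 i fun h5 => ?_, h2 fun h5 => ?_⟩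
    · exact Finset.prod_ne_zero_iff.1 h3 i (Finset.mem_univ i) (by rw [h5, ENNReal.zero_rpow_of_pos hc0])
    · exact h4 (by rw [h5, ENNReal.zero_rpow_of_pos hc0])
  calc ∫⁻ x : ι → ℝ, (∏ i, f i (x i) ^ c) * g (-∑ i, x i) ^ c
      = ∫⁻ x in A, (∏ i, f i (x i) ^ c) * g (-∑ i, x i) ^ c := by
        rw [← lintegral_indicator hAm]
        refine lintegral_congr_ae ?_
        filter_upwards [hzero] with x hx
        by_cases h : x ∈ A
        · rw [Set.indicator_of_mem h]
        · rw [Set.indicator_of_notMem h, hx h]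
    _ ≤ ∫⁻ x in A, ENNReal.ofReal N⁻¹ * (ENNReal.ofReal |(Φ' x).det| * γ (Φ x)) :=
        setLIntegral_mono' hAm hpt
    _ = ENNReal.ofReal N⁻¹ * ∫⁻ y in Φ '' A, γ y := by
        rw [lintegral_const_mul' _ _ ENNReal.ofReal_ne_top,
          lintegral_image_eq_lintegral_abs_det_fderiv_mul volume hAm hderiv hinj]
    _ ≤ ENNReal.ofReal N⁻¹ * ∫⁻ y, γ y := by
        gcongr
        exact Measure.restrict_le_self
    _ = ENNReal.ofReal (convConst (Fintype.card ι)) := by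
        rw [hγ, lintegral_gaussian_dual hc0, ← ENNReal.ofReal_mul (by positivity), convConst, ← hN,
          ← hc, ← mul_assoc]
        congr 2
        have := Real.mul_self_sqrt hN0.le
        field_simp
        linarith

/-- The convolution inequality at the origin with exponent `conjExp` and constant `K`. -/
def ConvIneq (ι E : Type*) [Fintype ι] [AddCommGroup E] [MeasureSpace E] (K : ℝ≥0∞) : Prop :=
  ∀ (f : ι → E → ℝ≥0∞) (g : E → ℝ≥0∞), (∀ i, Measurable (f i)) → Measurable g →
    ∫⁻ x : ι → E, (∏ i, f i (x i) ^ conjExp (Fintype.card ι)) *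
        g (-∑ i, x i) ^ conjExp (Fintype.card ι) ≤
      K * ((∏ i, (∫⁻ x, f i x) ^ conjExp (Fintype.card ι)) *
        (∫⁻ x, g x) ^ conjExp (Fintype.card ι))

theorem convIneq_real (ι : Type*) [Fintype ι] [Nonempty ι] :
    ConvIneq ι ℝ (ENNReal.ofReal (convConst (Fintype.card ι))) := by
  intro f g hf hg
  set c := conjExp (Fintype.card ι) with hc
  have hc0 : 0 < c := conjExp_pos Fintype.card_pos
  by_cases h0 : (∃ i, ∫⁻ x, f i x = 0) ∨ ∫⁻ x, g x = 0
  · refine le_of_eq_of_le ?_ zero_le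
    rw [lintegral_eq_zero_iff (by fun_prop)]
    rcases h0 with ⟨i, hi⟩ | h
    · rw [lintegral_eq_zero_iff (hf i)] at hi
      filter_upwards [ae_pi_eval_mem i hi] with x hx
      rw [Finset.prod_eq_zero (Finset.mem_univ i), zero_mul, Pi.zero_apply]
      rw [hx, Pi.zero_apply, ENNReal.zero_rpow_of_pos hc0]
    · rw [lintegral_eq_zero_iff hg] at h
      filter_upwards [ae_neg_sum_mem (ι := ι) h] with x hx
      rw [hx, Pi.zero_apply, ENNReal.zero_rpow_of_pos hc0, mul_zero, Pi.zero_apply]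
  push Not at h0
  obtain ⟨hf0, hg0⟩ := h0
  have hf0' : ∀ i, (∫⁻ x, f i x) ^ c ≠ 0 := fun i => by
    simp [ENNReal.rpow_eq_zero_iff, hf0 i, hc0.not_gt]
  have hg0' : (∫⁻ x, g x) ^ c ≠ 0 := by simp [ENNReal.rpow_eq_zero_iff, hg0, hc0.not_gt]
  have hK : ENNReal.ofReal (convConst (Fintype.card ι)) ≠ 0 := by
    simpa using convConst_pos (Fintype.card_pos (α := ι))
  by_cases htop : (∃ i, ∫⁻ x, f i x = ∞) ∨ ∫⁻ x, g x = ∞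
  · have : (∏ i, (∫⁻ x, f i x) ^ c) * (∫⁻ x, g x) ^ c = ∞ := by
      rcases htop with ⟨i, hi⟩ | h
      · classical
        rw [ENNReal.mul_eq_top]
        refine Or.inr ⟨?_, hg0'⟩
        rw [← Finset.mul_prod_erase _ _ (Finset.mem_univ i), hi, ENNReal.top_rpow_of_pos hc0,
          ENNReal.top_mul]
        exact Finset.prod_ne_zero_iff.2 fun j _ => hf0' j
      · rw [h, ENNReal.top_rpow_of_pos hc0, ENNReal.mul_top]
        exact Finset.prod_ne_zero_iff.2 fun j _ => hf0' j
    rw [this, ENNReal.mul_top hK]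
    exact le_top
  push Not at htop
  obtain ⟨hft, hgt⟩ := htop
  have main := lintegral_prod_rpow_le_of_density (f := fun i x => (∫⁻ x, f i x)⁻¹ * f i x)
    (g := fun x => (∫⁻ x, g x)⁻¹ * g x) (fun i => (hf i).const_mul _) (hg.const_mul _)
    (fun i => by
      rw [lintegral_const_mul _ (hf i), ENNReal.inv_mul_cancel (hf0 i) (hft i)])
    (by rw [lintegral_const_mul _ hg, ENNReal.inv_mul_cancel hg0 hgt])
  rw [← hc] at main
  set B := (∏ i, (∫⁻ x, f i x) ^ c) * (∫⁻ x, g x) ^ c with hB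
  have hB0 : B ≠ 0 := mul_ne_zero (Finset.prod_ne_zero_iff.2 fun j _ => hf0' j) hg0'
  have hBt : B ≠ ∞ := ENNReal.mul_ne_top
    (ENNReal.prod_ne_top fun i _ => ENNReal.rpow_ne_top_of_nonneg hc0.le (hft i))
    (ENNReal.rpow_ne_top_of_nonneg hc0.le hgt)
  have hBinv : (∏ i, ((∫⁻ x, f i x)⁻¹) ^ c) * ((∫⁻ x, g x)⁻¹) ^ c = B⁻¹ := by
    simp_rw [ENNReal.inv_rpow]
    rw [hB, ENNReal.mul_inv (Or.inr (ENNReal.rpow_ne_top_of_nonneg hc0.le hgt)) (Or.inr hg0'),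
      ENNReal.prod_inv_distrib]
    intro i _ j _ _
    exact Or.inl (hf0' i)
  have hsplit : ∀ x : ι → ℝ, (∏ i, ((∫⁻ x, f i x)⁻¹ * f i (x i)) ^ c) *
      ((∫⁻ x, g x)⁻¹ * g (-∑ i, x i)) ^ c =
      B⁻¹ * ((∏ i, f i (x i) ^ c) * g (-∑ i, x i) ^ c) := by
    intro x
    simp_rw [ENNReal.mul_rpow_of_nonneg _ _ hc0.le, Finset.prod_mul_distrib]
    rw [← hBinv]
    ring
  simp_rw [hsplit] at main
  rw [lintegral_const_mul' _ _ (ENNReal.inv_ne_top.2 hB0)] at main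
  calc _ = B * (B⁻¹ * ∫⁻ x : ι → ℝ, (∏ i, f i (x i) ^ c) * g (-∑ i, x i) ^ c) := by
        rw [← mul_assoc, ENNReal.mul_inv_cancel hB0 hBt, one_mul]
    _ ≤ B * ENNReal.ofReal (convConst (Fintype.card ι)) := by gcongr
    _ = _ := mul_comm _ _

theorem ConvIneq.prod {ι E F : Type*} [Fintype ι] [AddCommGroup E] [MeasureSpace E]
    [AddCommGroup F] [MeasureSpace F] [MeasurableAdd₂ E] [MeasurableNeg E] [MeasurableAdd₂ F]
    [MeasurableNeg F] [SigmaFinite (volume : Measure E)] [SigmaFinite (volume : Measure F)]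
    {K L : ℝ≥0∞} (hE : ConvIneq ι E K) (hF : ConvIneq ι F L) : ConvIneq ι (E × F) (K * L) := by
  intro f g hf hg
  set c := conjExp (Fintype.card ι) with hc
  have e := (volume_measurePreserving_arrowProdEquivProdArrow E F ι).symm
  rw [← e.lintegral_comp_emb (MeasurableEquiv.measurableEmbedding _)]
  have hrw : ∀ z : (ι → E) × (ι → F),
      (∏ i, f i ((MeasurableEquiv.arrowProdEquivProdArrow E F ι).symm z i) ^ c) *
        g (-∑ i, (MeasurableEquiv.arrowProdEquivProdArrow E F ι).symm z i) ^ c =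
      (∏ i, f i (z.1 i, z.2 i) ^ c) * g (-∑ i, z.1 i, -∑ i, z.2 i) ^ c := by
    intro z
    have : ∀ i, (MeasurableEquiv.arrowProdEquivProdArrow E F ι).symm z i = (z.1 i, z.2 i) :=
      fun i => rfl
    simp_rw [this]
    congr 3
    ext <;> simp [Prod.fst_sum, Prod.snd_sum]
  simp_rw [hrw]
  have hmeas : Measurable fun z : (ι → E) × (ι → F) =>
      (∏ i, f i (z.1 i, z.2 i) ^ c) * g (-∑ i, z.1 i, -∑ i, z.2 i) ^ c := by fun_prop
  rw [Measure.volume_eq_prod, lintegral_prod _ hmeas.aemeasurable]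
  calc ∫⁻ x : ι → E, ∫⁻ y : ι → F,
        (∏ i, f i (x i, y i) ^ c) * g (-∑ i, x i, -∑ i, y i) ^ c
      ≤ ∫⁻ x : ι → E, L * ((∏ i, (∫⁻ y, f i (x i, y)) ^ c) * (∫⁻ y, g (-∑ i, x i, y)) ^ c) :=
        lintegral_mono fun x => hF (fun i y => f i (x i, y)) (fun y => g (-∑ i, x i, y))
          (fun i => by fun_prop) (by fun_prop)
    _ = L * ∫⁻ x : ι → E, (∏ i, (∫⁻ y, f i (x i, y)) ^ c) * (∫⁻ y, g (-∑ i, x i, y)) ^ c := by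
        rw [lintegral_const_mul]
        refine Measurable.mul ?_ ?_
        · refine Finset.measurable_prod _ fun i _ => Measurable.pow_const ?_ _
          exact ((hf i).lintegral_prod_right').comp (measurable_pi_apply i)
        · refine Measurable.pow_const ?_ _
          exact hg.lintegral_prod_right'.comp
            (show Measurable fun x : ι → E => -∑ i, x i by fun_prop)
    _ ≤ L * (K * ((∏ i, (∫⁻ x, ∫⁻ y, f i (x, y)) ^ c) * (∫⁻ x, ∫⁻ y, g (x, y)) ^ c)) := by
        gcongr
        exact hE (fun i x => ∫⁻ y, f i (x, y)) (fun x => ∫⁻ y, g (x, y))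
          (fun i => (hf i).lintegral_prod_right') hg.lintegral_prod_right'
    _ = K * L * ((∏ i, (∫⁻ z, f i z) ^ c) * (∫⁻ z, g z) ^ c) := by
        have h : ∀ k : E × F → ℝ≥0∞, Measurable k →
            ∫⁻ z, k z = ∫⁻ x, ∫⁻ y, k (x, y) := fun k hk => by
          rw [Measure.volume_eq_prod, lintegral_prod _ hk.aemeasurable]
        rw [h g hg]
        simp_rw [fun i => h (f i) (hf i)]
        ring

theorem ConvIneq.of_equiv {ι E F : Type*} [Fintype ι] [AddCommGroup E] [MeasureSpace E]
    [AddCommGroup F] [MeasureSpace F] [SigmaFinite (volume : Measure E)]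
    [SigmaFinite (volume : Measure F)] {K : ℝ≥0∞} (hE : ConvIneq ι E K) (e : E ≃ᵐ F)
    (he : MeasurePreserving e) (hadd : ∀ x y, e (x + y) = e x + e y) : ConvIneq ι F K := by
  intro f g hf hg
  set c := conjExp (Fintype.card ι) with hc
  let a : E →+ F := AddMonoidHom.mk' e hadd
  have hpi : MeasurePreserving (fun (x : ι → E) i => e (x i)) :=
    measurePreserving_pi (fun _ => volume) (fun _ => volume) fun _ => he
  have hemb : MeasurableEmbedding (fun (x : ι → E) i => e (x i)) :=
    (MeasurableEquiv.piCongrRight fun _ : ι => e).measurableEmbedding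
  have hneg : ∀ x : ι → E, -∑ i, e (x i) = e (-∑ i, x i) := fun x => by
    change -∑ i, a (x i) = a (-∑ i, x i)
    simp
  rw [← hpi.lintegral_comp_emb hemb]
  simp_rw [hneg, ← he.lintegral_comp_emb e.measurableEmbedding]
  exact hE (fun i x => f i (e x)) (fun x => g (e x)) (fun i => (hf i).comp e.measurable)
    (hg.comp e.measurable)

theorem ConvIneq.of_subsingleton {ι E : Type*} [Fintype ι] [AddCommGroup E] [MeasureSpace E]
    [Subsingleton E] [IsProbabilityMeasure (volume : Measure E)] : ConvIneq ι E 1 := by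
  intro f g hf hg
  have h : ∀ F : E → ℝ≥0∞, ∫⁻ x, F x = F 0 := fun F => by
    rw [lintegral_congr fun x => congrArg F (Subsingleton.elim x 0)]
    simp
  have h' : ∀ F : (ι → E) → ℝ≥0∞, ∫⁻ x, F x = F 0 := fun F => by
    rw [lintegral_congr fun x => congrArg F (Subsingleton.elim x 0)]
    simp
  simp_rw [h, h']
  simp

theorem convIneq_pi (ι : Type*) [Fintype ι] [Nonempty ι] (d : ℕ) :
    ConvIneq ι (Fin d → ℝ) (ENNReal.ofReal (convConst (Fintype.card ι)) ^ d) := by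
  induction d with
  | zero =>
    rw [pow_zero]
    have : IsProbabilityMeasure (volume : Measure (Fin 0 → ℝ)) :=
      ⟨by rw [volume_pi, Measure.pi_univ]; simp⟩
    exact ConvIneq.of_subsingleton
  | succ d ih =>
    rw [pow_succ']
    refine ((convIneq_real ι).prod ih).of_equiv
      (MeasurableEquiv.piFinSuccAbove (fun _ : Fin (d + 1) => ℝ) 0).symm
      (volume_preserving_piFinSuccAbove (fun _ : Fin (d + 1) => ℝ) 0).symm ?_
    intro x y
    ext i
    refine Fin.cases ?_ (fun j => ?_) i <;> simp [MeasurableEquiv.piFinSuccAbove]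

theorem convIneq_euclideanSpace (ι : Type*) [Fintype ι] [Nonempty ι] (d : ℕ) :
    ConvIneq ι (EuclideanSpace ℝ (Fin d)) (ENNReal.ofReal (convConst (Fintype.card ι)) ^ d) :=
  (convIneq_pi ι d).of_equiv (MeasurableEquiv.toLp 2 (Fin d → ℝ))
    (PiLp.volume_preserving_toLp (Fin d)) fun _ _ => rfl

/-- The Fourier transform of a Gaussian of height one has total mass one. -/
theorem lintegral_enorm_fourier_gaussian {E : Type*} [NormedAddCommGroup E]
    [InnerProductSpace ℝ E] [FiniteDimensional ℝ E] [MeasurableSpace E] [BorelSpace E]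
    {b : ℝ} (hb : 0 < b) :
    ∫⁻ w : E, ‖𝓕 (fun v : E => Complex.exp (-(b : ℂ) * ‖v‖ ^ 2)) w‖ₑ = 1 := by
  have hb' : 0 < π ^ 2 / b := by positivity
  have h : ∀ w : E, ‖𝓕 (fun v : E => Complex.exp (-(b : ℂ) * ‖v‖ ^ 2)) w‖ₑ =
      ENNReal.ofReal ((π / b) ^ (Module.finrank ℝ E / 2 : ℝ) *
        Real.exp (-(π ^ 2 / b) * ‖w‖ ^ 2)) := by
    intro w
    rw [fourier_gaussian_innerProductSpace (by simpa using hb), ← ofReal_norm]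
    congr 1
    have h1 : ((π : ℂ) / b) ^ ((Module.finrank ℝ E : ℂ) / 2) =
        (((π / b) ^ (Module.finrank ℝ E / 2 : ℝ) : ℝ) : ℂ) := by
      rw [Complex.ofReal_cpow (by positivity)]
      push_cast
      rfl
    have h2 : -(π : ℂ) ^ 2 * ‖w‖ ^ 2 / b = ((-(π ^ 2 / b) * ‖w‖ ^ 2 : ℝ) : ℂ) := by
      push_cast
      ring
    rw [h1, h2, ← Complex.ofReal_exp, ← Complex.ofReal_mul, Complex.norm_real, Real.norm_eq_abs,
      abs_of_pos (by positivity)]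
  have hint : Integrable fun w : E => Real.exp (-(π ^ 2 / b) * ‖w‖ ^ 2) := by
    by_contra hni
    have h0 := GaussianFourier.integral_rexp_neg_mul_sq_norm (V := E) hb'
    rw [integral_undef hni] at h0
    exact absurd h0 (by positivity)
  simp_rw [h]
  rw [← ofReal_integral_eq_lintegral_ofReal (hint.const_mul _)
    (ae_of_all _ fun w => by positivity), integral_const_mul,
    GaussianFourier.integral_rexp_neg_mul_sq_norm hb', ← Real.mul_rpow (by positivity) (by positivity)]
  have : π / b * (π / (π ^ 2 / b)) = 1 := by field_simp
  rw [this, Real.one_rpow, ENNReal.ofReal_one]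

theorem integrable_cexp_neg_mul_sq_norm {E : Type*} [NormedAddCommGroup E]
    [InnerProductSpace ℝ E] [FiniteDimensional ℝ E] [MeasurableSpace E] [BorelSpace E]
    {b : ℝ} (hb : 0 < b) : Integrable fun v : E => Complex.exp (-(b : ℂ) * ‖v‖ ^ 2) := by
  have := GaussianFourier.integrable_cexp_neg_mul_sq_norm_add (V := E) (b := b)
    (by simpa using hb) 0 0
  simpa using this

theorem AddChar.coe_sum_eq_prod {ι A : Type*} [AddCommMonoid A] (e : AddChar A Circle)
    (s : Finset ι) (a : ι → A) : (e (∑ i ∈ s, a i) : ℂ) = ∏ i ∈ s, (e (a i) : ℂ) := by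
  classical
  induction s using Finset.induction_on with
  | empty => simp
  | insert i s hi ih =>
    rw [Finset.sum_insert hi, Finset.prod_insert hi, AddChar.map_add_eq_mul, Circle.coe_mul, ih]

/-- The pairing of `(x, y)` with `ξ` through `∑ i, x i + y`. -/
noncomputable def sumPairing (ι E : Type*) [Fintype ι] [NormedAddCommGroup E]
    [InnerProductSpace ℝ E] : (ι → E) × E →ₗ[ℝ] E →ₗ[ℝ] ℝ :=
  (innerₗ E).comp ((∑ i, (LinearMap.proj i).comp (LinearMap.fst ℝ (ι → E) E)) +
    LinearMap.snd ℝ (ι → E) E)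

theorem sumPairing_apply {ι E : Type*} [Fintype ι] [NormedAddCommGroup E]
    [InnerProductSpace ℝ E] (z : (ι → E) × E) (ξ : E) :
    sumPairing ι E z ξ = inner ℝ (∑ i, z.1 i + z.2) ξ := by
  simp [sumPairing, inner_add_left, sum_inner]

section
variable {E : Type*} [NormedAddCommGroup E] [InnerProductSpace ℝ E] [FiniteDimensional ℝ E]
  [MeasurableSpace E] [BorelSpace E]

theorem fourierIntegral_sumPairing {ι : Type*} [Fintype ι] (G : ι → E → ℂ) (H : E → ℂ) (ξ : E) :
    VectorFourier.fourierIntegral 𝐞 volume (sumPairing ι E)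
      (fun z => (∏ i, G i (z.1 i)) * H z.2) ξ = (∏ i, 𝓕 (G i) ξ) * 𝓕 H ξ := by
  simp only [VectorFourier.fourierIntegral, Real.fourier_eq]
  rw [← integral_fintype_prod_volume_eq_prod (f := fun i v => 𝐞 (-inner ℝ v ξ) • G i v),
    ← integral_prod_mul, ← Measure.volume_eq_prod]
  refine integral_congr_ae (ae_of_all _ fun z => ?_)
  simp only [sumPairing_apply, inner_add_left, sum_inner, neg_add, ← Finset.sum_neg_distrib,
    AddChar.map_add_eq_mul, AddChar.coe_sum_eq_prod, Circle.smul_def, smul_eq_mul,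
    Circle.coe_mul, Finset.prod_mul_distrib]
  ring

/-- Gaussian-regularised integral of a product of Fourier transforms. -/
theorem enorm_integral_gaussian_mul_prod_fourier_le {ι : Type*} [Fintype ι] [Nonempty ι]
    {K : ℝ≥0∞} (hK : ConvIneq ι E K) {G : ι → E → ℂ} {H : E → ℂ} (hG : ∀ i, Integrable (G i))
    (hH : Integrable H) (hGm : ∀ i, Measurable (G i)) (hHm : Measurable H) {b : ℝ} (hb : 0 < b) :
    ‖∫ ξ, ((∏ i, 𝓕 (G i) ξ) * 𝓕 H ξ) * Complex.exp (-(b : ℂ) * ‖ξ‖ ^ 2)‖ₑ ≤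
      K * ((∏ i, (∫⁻ x, ‖G i x‖ₑ ^ (conjExp (Fintype.card ι))⁻¹) ^ conjExp (Fintype.card ι)) *
        (∫⁻ x, ‖H x‖ₑ ^ (conjExp (Fintype.card ι))⁻¹) ^ conjExp (Fintype.card ι)) := by
  set c := conjExp (Fintype.card ι) with hc
  have hc0 : c ≠ 0 := (conjExp_pos Fintype.card_pos).ne'
  set γ : E → ℂ := fun v => Complex.exp (-(b : ℂ) * ‖v‖ ^ 2) with hγ
  have hLc : Continuous fun p : ((ι → E) × E) × E => sumPairing ι E p.1 p.2 := by
    simp only [sumPairing_apply]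
    fun_prop
  have hF : Integrable fun z : (ι → E) × E => (∏ i, G i (z.1 i)) * H z.2 :=
    (Integrable.fintype_prod hG).mul_prod hH
  have hflip := VectorFourier.integral_fourierIntegral_smul_eq_flip (ν := volume)
    Real.continuous_fourierChar hLc hF (integrable_cexp_neg_mul_sq_norm (E := E) hb)
  simp only [fourierIntegral_sumPairing, smul_eq_mul] at hflip
  have hγflip : ∀ z : (ι → E) × E, VectorFourier.fourierIntegral 𝐞 volume (sumPairing ι E).flip
      γ z = 𝓕 γ (∑ i, z.1 i + z.2) := by
    intro z
    simp only [VectorFourier.fourierIntegral, Real.fourier_eq, LinearMap.flip_apply,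
      sumPairing_apply, real_inner_comm]
  have hγm : Measurable (𝓕 γ) := by
    have : 𝓕 γ = fun w => (π / b : ℂ) ^ (Module.finrank ℝ E / 2 : ℂ) *
        Complex.exp (-π ^ 2 * ‖w‖ ^ 2 / b) := by
      ext w
      exact fourier_gaussian_innerProductSpace (by simpa using hb) w
    rw [this]
    fun_prop
  rw [hflip]
  refine (enorm_integral_le_lintegral_enorm _).trans ?_
  simp_rw [← hγ, hγflip, enorm_mul]
  have hprod : ∀ z : (ι → E) × E, ‖∏ i, G i (z.1 i)‖ₑ = ∏ i, ‖G i (z.1 i)‖ₑ := fun z => by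
    simp [enorm_eq_nnnorm, nnnorm_prod]
  simp_rw [hprod]
  have hpow : ∀ u : ℝ≥0∞, (u ^ c⁻¹) ^ c = u := fun u => by
    rw [← ENNReal.rpow_mul, inv_mul_cancel₀ hc0, ENNReal.rpow_one]
  rw [Measure.volume_eq_prod, lintegral_prod _ (by fun_prop)]
  calc ∫⁻ x : ι → E, ∫⁻ y : E, (∏ i, ‖G i (x i)‖ₑ) * ‖H y‖ₑ * ‖𝓕 γ (∑ i, x i + y)‖ₑ
      = ∫⁻ x : ι → E, ∫⁻ w : E, ‖𝓕 γ w‖ₑ * ((∏ i, ‖G i (x i)‖ₑ) * ‖H (w + -∑ i, x i)‖ₑ) := by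
        refine lintegral_congr fun x => ?_
        rw [← lintegral_add_left_eq_self (fun w => ‖𝓕 γ w‖ₑ *
          ((∏ i, ‖G i (x i)‖ₑ) * ‖H (w + -∑ i, x i)‖ₑ)) (∑ i, x i)]
        refine lintegral_congr fun y => ?_
        rw [add_neg_cancel_comm, mul_comm]
    _ = ∫⁻ w : E, ‖𝓕 γ w‖ₑ * ∫⁻ x : ι → E, (∏ i, (‖G i (x i)‖ₑ ^ c⁻¹) ^ c) *
          (‖H (w + -∑ i, x i)‖ₑ ^ c⁻¹) ^ c := by
        rw [lintegral_lintegral_swap (by fun_prop)]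
        refine lintegral_congr fun w => ?_
        simp_rw [hpow]
        exact lintegral_const_mul _ (by fun_prop)
    _ ≤ ∫⁻ w : E, ‖𝓕 γ w‖ₑ * (K * ((∏ i, (∫⁻ x, ‖G i x‖ₑ ^ c⁻¹) ^ c) *
          (∫⁻ x, ‖H x‖ₑ ^ c⁻¹) ^ c)) := by
        refine lintegral_mono fun w => mul_le_mul_right ?_ _
        refine (hK (fun i x => ‖G i x‖ₑ ^ c⁻¹) (fun x => ‖H (w + x)‖ₑ ^ c⁻¹)
          (fun i => by fun_prop) (by fun_prop)).trans_eq ?_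
        rw [← hc, lintegral_add_left_eq_self (fun x => ‖H x‖ₑ ^ c⁻¹) w]
    _ = K * ((∏ i, (∫⁻ x, ‖G i x‖ₑ ^ c⁻¹) ^ c) * (∫⁻ x, ‖H x‖ₑ ^ c⁻¹) ^ c) := by
        rw [lintegral_mul_const _ (by fun_prop), lintegral_enorm_fourier_gaussian hb, one_mul]

theorem fourier_conj_neg (g : E → ℂ) (ξ : E) :
    𝓕 (fun x => (starRingEnd ℂ) (g (-x))) ξ = (starRingEnd ℂ) (𝓕 g ξ) := by
  rw [Real.fourier_eq, Real.fourier_eq, ← integral_conj, ← integral_neg_eq_self]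
  refine integral_congr_ae (ae_of_all _ fun x => ?_)
  simp only [neg_neg, inner_neg_left, Circle.smul_def, smul_eq_mul, map_mul]
  rw [← Circle.coe_inv_eq_conj, ← AddChar.map_neg_eq_inv, neg_neg]

theorem continuous_fourier_of_integrable {g : E → ℂ} (hg : Integrable g) : Continuous (𝓕 g) :=
  VectorFourier.fourierIntegral_continuous Real.continuous_fourierChar
    (by exact continuous_inner) hg

/-- The Hausdorff--Young inequality for an even dual exponent `2 * (m + 1)`. -/
theorem lintegral_fourier_pow_le {m : ℕ} {K : ℝ≥0∞} (hK : ConvIneq (Fin (m + 1) ⊕ Fin m) E K)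
    {g : E → ℂ} (hg : Integrable g) (hgm : Measurable g) :
    ∫⁻ ξ, ‖𝓕 g ξ‖ₑ ^ (2 * (m + 1)) ≤
      K * (∫⁻ x, ‖g x‖ₑ ^ (conjExp (2 * m + 1))⁻¹) ^ (2 * m + 1) := by
  set g' : E → ℂ := fun x => (starRingEnd ℂ) (g (-x)) with hg'
  have hg'm : Measurable g' := by fun_prop
  have hg'int : Integrable g' := by
    refine (hg.comp_neg).congr' (by fun_prop) (ae_of_all _ fun x => ?_)
    simp [hg']
  have hcard : Fintype.card (Fin (m + 1) ⊕ Fin m) = 2 * m + 1 := by simp; ring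
  set c := conjExp (2 * m + 1) with hc
  set R := K * (∫⁻ x, ‖g x‖ₑ ^ c⁻¹) ^ (2 * m + 1) with hR
  have hnorm : ∫⁻ x, ‖g' x‖ₑ ^ c⁻¹ = ∫⁻ x, ‖g x‖ₑ ^ c⁻¹ := by
    rw [← lintegral_neg_eq_self (fun x => ‖g x‖ₑ ^ c⁻¹)]
    simp [hg']
  have hbound : ∀ b : ℝ, 0 < b → ∫⁻ ξ, ‖𝓕 g ξ‖ₑ ^ (2 * (m + 1)) *
      ENNReal.ofReal (Real.exp (-b * ‖ξ‖ ^ 2)) ≤ R := by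
    intro b hb
    have hmain := enorm_integral_gaussian_mul_prod_fourier_le hK
      (G := Sum.elim (fun _ => g) fun _ => g') (H := g')
      (by rintro (i | i) <;> assumption) hg'int (by rintro (i | i) <;> assumption) hg'm hb
    rw [hcard] at hmain
    simp only [Fintype.prod_sum_type, Sum.elim_inl, Sum.elim_inr, Finset.prod_const,
      Finset.card_univ, Fintype.card_fin, ← hc, hnorm] at hmain
    have e1 : ((∫⁻ x, ‖g x‖ₑ ^ c⁻¹) ^ c) ^ (m + 1) * ((∫⁻ x, ‖g x‖ₑ ^ c⁻¹) ^ c) ^ m *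
        (∫⁻ x, ‖g x‖ₑ ^ c⁻¹) ^ c = (∫⁻ x, ‖g x‖ₑ ^ c⁻¹) ^ (2 * m + 1) := by
      rw [← pow_add, ← pow_succ, ← ENNReal.rpow_natCast, ← ENNReal.rpow_mul,
        ← ENNReal.rpow_natCast]
      congr 1
      rw [hc, conjExp]
      push_cast
      field_simp
      ring
    have e2 : ∀ ξ : E, 𝓕 g ξ ^ (m + 1) * 𝓕 g' ξ ^ m * 𝓕 g' ξ *
        Complex.exp (-(b : ℂ) * ‖ξ‖ ^ 2) =
        ((‖𝓕 g ξ‖ ^ (2 * (m + 1)) * Real.exp (-b * ‖ξ‖ ^ 2) : ℝ) : ℂ) := by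
      intro ξ
      rw [hg', fourier_conj_neg, mul_assoc (_ ^ _), ← pow_succ, ← mul_pow, Complex.mul_conj']
      push_cast
      ring
    rw [e1] at hmain
    simp_rw [e2] at hmain
    rw [integral_complex_ofReal, ← ofReal_norm, Complex.norm_real,
      Real.norm_of_nonneg (integral_nonneg fun ξ => by positivity),
      ofReal_integral_eq_lintegral_ofReal _ (ae_of_all _ fun ξ => by positivity)] at hmain
    · refine le_trans (le_of_eq (lintegral_congr fun ξ => ?_)) hmain
      rw [ENNReal.ofReal_mul (by positivity), ENNReal.ofReal_pow (norm_nonneg _), ofReal_norm]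
    · have hγ := (integrable_cexp_neg_mul_sq_norm (E := E) hb).norm
      refine Integrable.bdd_mul (c := (∫ x, ‖g x‖) ^ (2 * (m + 1))) ?_
        ((continuous_fourier_of_integrable hg).norm.pow _).aestronglyMeasurable
        (ae_of_all _ fun ξ => ?_)
      · refine hγ.congr (ae_of_all _ fun ξ => ?_)
        simp [Complex.norm_exp, ← Complex.ofReal_pow]
      · rw [Real.norm_of_nonneg (by positivity)]
        gcongr
        exact VectorFourier.norm_fourierIntegral_le_integral_norm _ _ _ _ _
  have hFm : Measurable (𝓕 g) := (continuous_fourier_of_integrable hg).measurable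
  set b : ℕ → ℝ := fun k => 1 / ((k : ℝ) + 1) with hb
  have hlim : ∀ ξ : E, Tendsto (fun k => ‖𝓕 g ξ‖ₑ ^ (2 * (m + 1)) *
      ENNReal.ofReal (Real.exp (-b k * ‖ξ‖ ^ 2))) atTop (𝓝 (‖𝓕 g ξ‖ₑ ^ (2 * (m + 1)))) := by
    intro ξ
    have h0 : Tendsto (fun k => Real.exp (-b k * ‖ξ‖ ^ 2)) atTop (𝓝 1) := by
      have := (((tendsto_one_div_add_atTop_nhds_zero_nat (𝕜 := ℝ)).neg.mul_const
        (‖ξ‖ ^ 2)).rexp)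
      simpa [hb] using this
    have h1 := ENNReal.tendsto_ofReal h0
    rw [ENNReal.ofReal_one] at h1
    simpa using ENNReal.Tendsto.const_mul h1 (Or.inl one_ne_zero)
  calc ∫⁻ ξ, ‖𝓕 g ξ‖ₑ ^ (2 * (m + 1))
      = ∫⁻ ξ, liminf (fun k => ‖𝓕 g ξ‖ₑ ^ (2 * (m + 1)) *
          ENNReal.ofReal (Real.exp (-b k * ‖ξ‖ ^ 2))) atTop :=
        lintegral_congr fun ξ => (hlim ξ).liminf_eq.symm
    _ ≤ liminf (fun k => ∫⁻ ξ, ‖𝓕 g ξ‖ₑ ^ (2 * (m + 1)) *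
          ENNReal.ofReal (Real.exp (-b k * ‖ξ‖ ^ 2))) atTop :=
        lintegral_liminf_le fun k => by fun_prop
    _ ≤ R := by
        refine (liminf_le_liminf (Eventually.of_forall fun k =>
          hbound (b k) (by positivity))).trans ?_
        simp

end
theorem lintegral_eq_mul_lintegral_comp_sqrt_smul {d : ℕ} {t : ℝ} (ht : 0 < t)
    (F : EuclideanSpace ℝ (Fin d) → ℝ≥0∞) :
    ∫⁻ x, F x = ENNReal.ofReal (t ^ ((d : ℝ) / 2)) * ∫⁻ x, F (√t • x) := by
  have hs : 0 < √t := Real.sqrt_pos.2 ht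
  have hmap : ∫⁻ x, F (√t • x) = ENNReal.ofReal |(√t ^ d)⁻¹| * ∫⁻ x, F x := by
    have h := Measure.map_addHaar_smul (volume : Measure (EuclideanSpace ℝ (Fin d))) hs.ne'
    rw [finrank_euclideanSpace_fin] at h
    rw [← smul_eq_mul, ← lintegral_smul_measure, ← h]
    exact (lintegral_map_equiv F (Homeomorph.smulOfNeZero (√t) hs.ne').toMeasurableEquiv).symm
  have hpow : √t ^ d = t ^ ((d : ℝ) / 2) := by
    rw [Real.sqrt_eq_rpow, ← Real.rpow_natCast, ← Real.rpow_mul ht.le]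
    ring_nf
  have hpos : 0 < t ^ ((d : ℝ) / 2) := by positivity
  rw [hmap, hpow, abs_of_pos (by positivity), ← mul_assoc, ← ENNReal.ofReal_mul hpos.le,
    mul_inv_cancel₀ hpos.ne', ENNReal.ofReal_one, one_mul]

section
variable {E : Type*} [NormedAddCommGroup E] [InnerProductSpace ℝ E] [FiniteDimensional ℝ E]
  [MeasurableSpace E] [BorelSpace E]

/-- The `L¹` modulus of continuity of `h` under translation. -/
noncomputable def translationModulus (h : E → ℝ) (y : E) : ℝ≥0∞ :=
  ∫⁻ x, ‖h (x - y) - h x‖ₑ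

theorem measurable_translationModulus {h : E → ℝ} (hm : Measurable h) :
    Measurable (translationModulus h) := by
  refine Measurable.lintegral_prod_right' (f := fun q : E × E => ‖h (q.2 - q.1) - h q.2‖ₑ) ?_
  fun_prop

theorem translationModulus_le {h : E → ℝ} (hm : Measurable h) (y : E) :
    translationModulus h y ≤ 2 * ∫⁻ x, ‖h x‖ₑ :=
  calc translationModulus h y ≤ ∫⁻ x, (‖h (x - y)‖ₑ + ‖h x‖ₑ) :=
        lintegral_mono fun x => enorm_sub_le
    _ = 2 * ∫⁻ x, ‖h x‖ₑ := by
        rw [lintegral_add_left (by fun_prop), lintegral_sub_right_eq_self (fun x => ‖h x‖ₑ),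
          two_mul]

theorem tendsto_translationModulus {h : E → ℝ} (hh : Integrable h) :
    Tendsto (translationModulus h) (𝓝 0) (𝓝 0) := by
  have hL : MemLp h 1 volume := memLp_one_iff_integrable.2 hh
  have key : ∀ y, translationModulus h y =
      edist (DomAddAct.mk (-y) +ᵥ hL.toLp h) (hL.toLp h) := by
    intro y
    rw [DomAddAct.mk_vadd_toLp, Lp.edist_toLp_toLp, eLpNorm_one_eq_lintegral_enorm]
    refine lintegral_congr fun x => ?_
    simp [sub_eq_neg_add]
  have : Fact ((1 : ℝ≥0∞) ≠ ∞) := ⟨ENNReal.one_ne_top⟩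
  have hcont : Continuous fun y : E => edist (DomAddAct.mk (-y) +ᵥ hL.toLp h) (hL.toLp h) := by
    have : Continuous fun y : E => DomAddAct.mk (-y) :=
      DomAddAct.continuous_mk.comp continuous_neg
    exact (this.vadd continuous_const).edist continuous_const
  have h0 := hcont.tendsto 0
  simp only [neg_zero, DomAddAct.mk_zero, zero_vadd, edist_self] at h0
  exact h0.congr fun y => (key y).symm

theorem lintegral_enorm_convolution_sub_le {φ h : E → ℝ} (hφ : Integrable φ)
    (hh : Integrable h) (hφm : Measurable φ) (hhm : Measurable h) :
    ∫⁻ x, ‖(∫ y, h (x - y) * φ y) - (∫ y, φ y) * h x‖ₑ ≤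
      ∫⁻ y, ‖φ y‖ₑ * translationModulus h y := by
  have hconv := (hφ.convolution_integrand (ContinuousLinearMap.mul ℝ ℝ) hh).prod_right_ae
  calc ∫⁻ x, ‖(∫ y, h (x - y) * φ y) - (∫ y, φ y) * h x‖ₑ
      ≤ ∫⁻ x, ∫⁻ y, ‖φ y‖ₑ * ‖h (x - y) - h x‖ₑ := by
        refine lintegral_mono_ae (hconv.mono fun x hx => ?_)
        have hx' : Integrable fun y => h (x - y) * φ y := by
          simpa [mul_comm] using hx
        rw [← integral_mul_const, ← integral_sub hx' (hφ.mul_const _)]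
        refine (enorm_integral_le_lintegral_enorm _).trans_eq (lintegral_congr fun y => ?_)
        rw [← enorm_mul]
        ring_nf
    _ = ∫⁻ y, ‖φ y‖ₑ * translationModulus h y := by
        rw [lintegral_lintegral_swap (by fun_prop)]
        exact lintegral_congr fun y => lintegral_const_mul _ (by fun_prop)

theorem abs_rpow_sub_rpow_rpow_le {p a b : ℝ} (hp : 1 ≤ p) (ha : 0 ≤ a) (hb : 0 ≤ b) :
    |a ^ (1 / p) - b ^ (1 / p)| ^ p ≤ |a - b| := by
  wlog hab : b ≤ a generalizing a b
  · rw [abs_sub_comm, abs_sub_comm a]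
    exact this hb ha (le_of_not_ge hab)
  have hp0 : p ≠ 0 := by positivity
  have hle : b ^ (1 / p) ≤ a ^ (1 / p) := by gcongr
  have hpow : ∀ x : ℝ, 0 ≤ x → (x ^ (1 / p)) ^ p = x := fun x hx => by
    rw [← Real.rpow_mul hx, one_div_mul_cancel hp0, Real.rpow_one]
  rw [abs_of_nonneg (sub_nonneg.2 hle), abs_of_nonneg (sub_nonneg.2 hab)]
  have h := Real.add_rpow_le_rpow_add (sub_nonneg.2 hle) (Real.rpow_nonneg hb (1 / p)) hp
  rw [sub_add_cancel, hpow a ha, hpow b hb] at h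
  linarith

theorem eLpNorm_rpow_sub_rpow_le {p : ℝ} (hp : 1 ≤ p) {u v : E → ℝ} (hu : ∀ x, 0 ≤ u x)
    (hv : ∀ x, 0 ≤ v x) :
    eLpNorm ((fun x => ((u x ^ (1 / p) : ℝ) : ℂ)) - fun x => ((v x ^ (1 / p) : ℝ) : ℂ))
      (ENNReal.ofReal p) volume ≤ (∫⁻ x, ‖u x - v x‖ₑ) ^ (1 / p) := by
  have hp0 : 0 < p := by positivity
  rw [eLpNorm_eq_lintegral_rpow_enorm_toReal (by simpa using hp0) ENNReal.ofReal_ne_top,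
    ENNReal.toReal_ofReal hp0.le]
  refine ENNReal.rpow_le_rpow (lintegral_mono fun x => ?_) (by positivity)
  rw [Pi.sub_apply, ← Complex.ofReal_sub, ← ofReal_norm, Complex.norm_real, ← ofReal_norm,
    ENNReal.ofReal_rpow_of_nonneg (norm_nonneg _) hp0.le]
  exact ENNReal.ofReal_le_ofReal (abs_rpow_sub_rpow_rpow_le hp (hu x) (hv x))

/-- Norms of Fourier transforms converge along `L^p`-asymptotic families, given an
`L^p` to `L^q` bound. -/
theorem tendsto_eLpNorm_fourier {α : Type*} {l : Filter α} {p q C L : ℝ≥0∞} (hq : 1 ≤ q)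
    (hC : C ≠ ⊤) (hL : L ≠ ⊤)
    (hbound : ∀ g : E → ℂ, Integrable g → Measurable g →
      eLpNorm (𝓕 g) q volume ≤ C * eLpNorm g p volume)
    {G g : α → E → ℂ} (hG : ∀ᶠ a in l, Integrable (G a)) (hGm : ∀ᶠ a in l, Measurable (G a))
    (hg : ∀ᶠ a in l, Integrable (g a)) (hgm : ∀ᶠ a in l, Measurable (g a))
    (hgL : ∀ᶠ a in l, eLpNorm (𝓕 (g a)) q volume = L)
    (hlim : Tendsto (fun a => eLpNorm (G a - g a) p volume) l (𝓝 0)) :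
    Tendsto (fun a => (eLpNorm (𝓕 (G a)) q volume).toReal) l (𝓝 L.toReal) := by
  refine (ENNReal.tendsto_toReal hL).comp ?_
  have hlimC : Tendsto (fun a => C * eLpNorm (G a - g a) p volume) l (𝓝 0) := by
    simpa using ENNReal.Tendsto.const_mul hlim (Or.inr hC)
  have hsub : ∀ g₁ g₂ : E → ℂ, Integrable g₁ → Integrable g₂ → 𝓕 (g₁ - g₂) = 𝓕 g₁ - 𝓕 g₂ := by
    intro g₁ g₂ h₁ h₂
    ext ξ
    simp only [Real.fourier_eq, Pi.sub_apply, smul_sub]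
    exact integral_sub ((Real.fourierIntegral_convergent_iff ξ).2 h₁)
      ((Real.fourierIntegral_convergent_iff ξ).2 h₂)
  have hm : ∀ {g₁ : E → ℂ}, Integrable g₁ → AEStronglyMeasurable (𝓕 g₁) volume := fun h =>
    (continuous_fourier_of_integrable h).aestronglyMeasurable
  refine tendsto_of_tendsto_of_tendsto_of_le_of_le'
    (g := fun a => L - C * eLpNorm (G a - g a) p volume)
    (h := fun a => L + C * eLpNorm (G a - g a) p volume) ?_ ?_ ?_ ?_
  · simpa using ENNReal.Tendsto.sub tendsto_const_nhds hlimC (Or.inl hL)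
  · simpa using tendsto_const_nhds.add hlimC
  · filter_upwards [hG, hGm, hg, hgm, hgL] with a h1 h2 h3 h4 h5
    rw [tsub_le_iff_right, ← h5]
    refine le_trans ?_ (add_le_add_right (hbound _ (h1.sub h3) (h2.sub h4)) _)
    rw [hsub _ _ h1 h3]
    calc eLpNorm (𝓕 (g a)) q volume
        = eLpNorm (𝓕 (G a) - (𝓕 (G a) - 𝓕 (g a))) q volume := by rw [sub_sub_cancel]
      _ ≤ _ := eLpNorm_sub_le (hm h1) ((hm h1).sub (hm h3)) hq
  · filter_upwards [hG, hGm, hg, hgm, hgL] with a h1 h2 h3 h4 h5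
    rw [← h5]
    refine le_trans ?_ (add_le_add_right (hbound _ (h1.sub h3) (h2.sub h4)) _)
    rw [hsub _ _ h1 h3]
    calc eLpNorm (𝓕 (G a)) q volume
        = eLpNorm (𝓕 (g a) + (𝓕 (G a) - 𝓕 (g a))) q volume := by rw [add_sub_cancel]
      _ ≤ _ := eLpNorm_add_le (hm h3) ((hm h1).sub (hm h3)) hq

end

theorem convConst_pow_rpow_eq {p : ℝ} (hp1 : 1 < p) {m : ℕ} (hm : p / (p - 1) = 2 * (m + 1))
    (d : ℕ) : (convConst (2 * m + 1) ^ d) ^ (p / (p - 1))⁻¹ =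
      (p ^ (1 / p) / (p / (p - 1)) ^ (1 - 1 / p)) ^ ((d : ℝ) / 2) := by
  have hp0 : 0 < p := by positivity
  have hp1' : 0 < p - 1 := by linarith
  set q := p / (p - 1) with hq
  have hq0 : 0 < q := by positivity
  have hqinv : 1 - 1 / p = q⁻¹ := by rw [hq]; field_simp
  have hn : (2 * m + 1 : ℝ) = q / p := by
    have h1 : q / p = q - 1 := by rw [hq]; field_simp; ring
    rw [h1, hm]; ring
  have hc : (conjExp (2 * m + 1))⁻¹ = p := by
    rw [conjExp, inv_div]
    push_cast
    rw [show (2 * m + 1 + 1 : ℝ) = q by rw [hm]; ring, hn]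
    field_simp
  have hconst : convConst (2 * m + 1) = q ^ (-(1 / 2) : ℝ) * p ^ (q / p / 2) := by
    rw [convConst, hc, Real.sqrt_eq_rpow, Real.sqrt_eq_rpow, ← Real.rpow_neg (by positivity),
      ← Real.rpow_natCast, ← Real.rpow_mul hp0.le]
    push_cast
    rw [show (2 * m + 1 + 1 : ℝ) = q by rw [hm]; ring, hn]
    ring_nf
  clear_value q
  rw [hconst, hqinv, ← Real.rpow_natCast, ← Real.rpow_mul (by positivity),
    Real.mul_rpow (by positivity) (by positivity), ← Real.rpow_mul hq0.le, ← Real.rpow_mul hp0.le,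
    Real.div_rpow (by positivity) (by positivity), ← Real.rpow_mul hq0.le,
    ← Real.rpow_mul hp0.le, div_eq_mul_inv (p ^ (1 / p * ((d : ℝ) / 2))), ← Real.rpow_neg hq0.le, mul_comm]
  congr 2
  · field_simp
  · ring

/-- The sharp Hausdorff--Young inequality when the dual exponent is `2 * (m + 1)`. -/
theorem eLpNorm_fourier_le {d m : ℕ} {p : ℝ} (hp1 : 1 < p) (hm : p / (p - 1) = 2 * (m + 1))
    {g : EuclideanSpace ℝ (Fin d) → ℂ} (hg : Integrable g) (hgm : Measurable g) :
    eLpNorm (𝓕 g) (ENNReal.ofReal (p / (p - 1))) volume ≤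
      ENNReal.ofReal ((p ^ (1 / p) / (p / (p - 1)) ^ (1 - 1 / p)) ^ ((d : ℝ) / 2)) *
        eLpNorm g (ENNReal.ofReal p) volume := by
  have hp0 : 0 < p := by positivity
  have hp1' : 0 < p - 1 := by linarith
  have hc : (conjExp (2 * m + 1))⁻¹ = p := by
    have h1 : (2 * m + 1 : ℝ) = 1 / (p - 1) := by
      rw [show (2 * m + 1 : ℝ) = 2 * (m + 1) - 1 by ring, ← hm]
      field_simp
      ring
    rw [conjExp, inv_div]
    push_cast
    rw [h1]
    field_simp
    ring
  have hK := convIneq_euclideanSpace (Fin (m + 1) ⊕ Fin m) d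
  rw [show Fintype.card (Fin (m + 1) ⊕ Fin m) = 2 * m + 1 by simp; ring] at hK
  have hmain := lintegral_fourier_pow_le hK hg hgm
  rw [← convConst_pow_rpow_eq hp1 hm]
  have hn : ((2 * m + 1 : ℕ) : ℝ) * (p / (p - 1))⁻¹ = 1 / p := by
    push_cast
    rw [show (2 * m + 1 : ℝ) = 2 * (m + 1) - 1 by ring, ← hm]
    field_simp
    ring
  set q := p / (p - 1) with hq
  have hq0 : 0 < q := by positivity
  have hconst := (convConst_pos (Nat.succ_pos (2 * m))).le
  rw [eLpNorm_eq_lintegral_rpow_enorm_toReal (by simpa using hq0) ENNReal.ofReal_ne_top,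
    eLpNorm_eq_lintegral_rpow_enorm_toReal (by simpa using hp0) ENNReal.ofReal_ne_top,
    ENNReal.toReal_ofReal hq0.le, ENNReal.toReal_ofReal hp0.le,
    ← ENNReal.ofReal_rpow_of_nonneg (pow_nonneg hconst d) (by positivity), one_div q, ← hn,
    ENNReal.rpow_mul, ENNReal.rpow_natCast, ← ENNReal.mul_rpow_of_nonneg _ _ (by positivity),
    ENNReal.ofReal_pow hconst]
  refine ENNReal.rpow_le_rpow ?_ (by positivity)
  rw [hc] at hmain
  refine le_trans (le_of_eq (lintegral_congr fun ξ => ?_)) hmain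
  rw [hm, ← ENNReal.rpow_natCast]
  push_cast
  rfl

theorem heatKernel_eq_const_mul (d : ℕ) (t : ℝ) (x : EuclideanSpace ℝ (Fin d)) :
    heatKernel d t x = t ^ (-(d : ℝ) / 2) * Real.exp (-(π / t) * ‖x‖ ^ 2) := by
  rw [heatKernel]
  ring_nf

theorem heatKernel_nonneg (d : ℕ) {t : ℝ} (ht : 0 < t) (x : EuclideanSpace ℝ (Fin d)) :
    0 ≤ heatKernel d t x := by
  unfold heatKernel
  positivity

theorem continuous_heatKernel (d : ℕ) (t : ℝ) : Continuous (heatKernel d t) := by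
  unfold heatKernel
  fun_prop

theorem integrable_heatKernel (d : ℕ) {t : ℝ} (ht : 0 < t) : Integrable (heatKernel d t) := by
  have h := (integrable_cexp_neg_mul_sq_norm (E := EuclideanSpace ℝ (Fin d))
    (b := π / t) (by positivity)).norm.const_mul (t ^ (-(d : ℝ) / 2))
  refine h.congr (ae_of_all _ fun x => ?_)
  simp only [heatKernel_eq_const_mul, Complex.norm_exp]
  norm_cast

theorem integral_heatKernel (d : ℕ) {t : ℝ} (ht : 0 < t) : ∫ x, heatKernel d t x = 1 := by
  simp_rw [heatKernel_eq_const_mul]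
  rw [integral_const_mul, GaussianFourier.integral_rexp_neg_mul_sq_norm (by positivity),
    div_div_cancel₀ Real.pi_ne_zero, finrank_euclideanSpace_fin, ← Real.rpow_add ht]
  ring_nf
  exact Real.rpow_zero t

theorem heatKernel_sqrt_smul (d : ℕ) {t : ℝ} (ht : 0 < t) (x : EuclideanSpace ℝ (Fin d)) :
    heatKernel d t (√t • x) = t ^ (-(d : ℝ) / 2) * heatKernel d 1 x := by
  rw [heatKernel, heatKernel, norm_smul, Real.norm_of_nonneg (Real.sqrt_nonneg t), mul_pow,
    Real.sq_sqrt ht.le, Real.one_rpow, one_mul]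
  congr 2
  field_simp

theorem ofReal_rpow_mul_enorm_rpow_neg_mul {d : ℕ} {t : ℝ} (ht : 0 < t) (a : ℝ) :
    ENNReal.ofReal (t ^ ((d : ℝ) / 2)) * ‖t ^ (-(d : ℝ) / 2) * a‖ₑ = ‖a‖ₑ := by
  have h : t ^ ((d : ℝ) / 2) * t ^ (-(d : ℝ) / 2) = 1 := by
    rw [← Real.rpow_add ht, neg_div, add_neg_cancel, Real.rpow_zero]
  rw [enorm_mul, ← mul_assoc, Real.enorm_of_nonneg (by positivity),
    ← ENNReal.ofReal_mul (by positivity), h, ENNReal.ofReal_one, one_mul]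

theorem translationModulus_heatKernel {d : ℕ} {t : ℝ} (ht : 0 < t)
    (y : EuclideanSpace ℝ (Fin d)) :
    translationModulus (heatKernel d t) y = translationModulus (heatKernel d 1) ((√t)⁻¹ • y) := by
  have hs : √t ≠ 0 := (Real.sqrt_pos.2 ht).ne'
  rw [translationModulus, lintegral_eq_mul_lintegral_comp_sqrt_smul ht,
    ← lintegral_const_mul' _ _ ENNReal.ofReal_ne_top]
  refine lintegral_congr fun x => ?_
  have : √t • x - y = √t • (x - (√t)⁻¹ • y) := by rw [smul_sub, smul_inv_smul₀ hs]
  rw [this, heatKernel_sqrt_smul d ht, heatKernel_sqrt_smul d ht, ← mul_sub,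
    ofReal_rpow_mul_enorm_rpow_neg_mul ht]

theorem lintegral_heatKernel_mul {d : ℕ} {t : ℝ} (ht : 0 < t)
    (F : EuclideanSpace ℝ (Fin d) → ℝ≥0∞) :
    ∫⁻ y, ‖heatKernel d t y‖ₑ * F y = ∫⁻ y, ‖heatKernel d 1 y‖ₑ * F (√t • y) := by
  rw [lintegral_eq_mul_lintegral_comp_sqrt_smul ht,
    ← lintegral_const_mul' _ _ ENNReal.ofReal_ne_top]
  refine lintegral_congr fun x => ?_
  rw [heatKernel_sqrt_smul d ht, ← mul_assoc, ofReal_rpow_mul_enorm_rpow_neg_mul ht]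

theorem tendsto_lintegral_mul_translationModulus {d : ℕ} {α : Type*} {l : Filter α}
    [l.IsCountablyGenerated] {φ h : EuclideanSpace ℝ (Fin d) → ℝ} (hφ : Integrable φ)
    (hφm : Measurable φ) (hh : Integrable h) (hhm : Measurable h) {r : α → ℝ}
    (hr : Tendsto r l (𝓝 0)) :
    Tendsto (fun a => ∫⁻ y, ‖φ y‖ₑ * translationModulus h (r a • y)) l (𝓝 0) := by
  have hωm := measurable_translationModulus hhm
  rw [← lintegral_zero (μ := (volume : Measure (EuclideanSpace ℝ (Fin d))))]
  refine tendsto_lintegral_filter_of_dominated_convergence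
    (fun y => ‖φ y‖ₑ * (2 * ∫⁻ x, ‖h x‖ₑ))
    (Eventually.of_forall fun a => by fun_prop)
    (Eventually.of_forall fun a => ae_of_all _ fun y =>
      mul_le_mul_right (translationModulus_le hhm _) _) ?_ (ae_of_all _ fun y => ?_)
  · rw [lintegral_mul_const _ (by fun_prop)]
    exact ENNReal.mul_ne_top hφ.2.ne (ENNReal.mul_ne_top ENNReal.ofNat_ne_top hh.2.ne)
  · have h0 : Tendsto (fun a => r a • y) l (𝓝 0) := by
      simpa using hr.smul_const y
    simpa using ENNReal.Tendsto.const_mul ((tendsto_translationModulus hh).comp h0)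
      (Or.inr enorm_ne_top)

theorem heatEvolution_withDensity {d : ℕ} {m : EuclideanSpace ℝ (Fin d) → ℝ}
    (hm : Measurable m) (hm0 : ∀ x, 0 ≤ m x) (t : ℝ) (x : EuclideanSpace ℝ (Fin d)) :
    heatEvolution d (volume.withDensity fun y => ENNReal.ofReal (m y)) t x =
      ∫ y, heatKernel d t (x - y) * m y := by
  rw [heatEvolution, integral_withDensity_eq_integral_toReal_smul (by fun_prop)
    (ae_of_all _ fun y => ENNReal.ofReal_lt_top)]
  refine integral_congr_ae (ae_of_all _ fun y => ?_)
  simp only [ENNReal.toReal_ofReal (hm0 y), smul_eq_mul]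
  ring

theorem tendsto_lintegral_convolution_heatKernel_sub_zero {d : ℕ}
    {m : EuclideanSpace ℝ (Fin d) → ℝ} (hmi : Integrable m) (hm : Measurable m) :
    Tendsto (fun t => ∫⁻ x, ‖(∫ y, heatKernel d t (x - y) * m y) - m x‖ₑ) (𝓝[>] 0) (𝓝 0) := by
  have hr : Tendsto (fun t : ℝ => √t) (𝓝[>] 0) (𝓝 0) := by
    have := (Real.continuous_sqrt.tendsto 0).mono_left (nhdsWithin_le_nhds (s := Set.Ioi 0))
    simpa using this
  refine tendsto_of_tendsto_of_tendsto_of_le_of_le' tendsto_const_nhds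
    (tendsto_lintegral_mul_translationModulus (integrable_heatKernel d one_pos)
      (continuous_heatKernel d 1).measurable hmi hm hr) (Eventually.of_forall fun _ => zero_le) ?_
  filter_upwards [self_mem_nhdsWithin] with t ht
  rw [← lintegral_heatKernel_mul ht]
  refine le_trans (le_of_eq (lintegral_congr fun x => ?_))
    (lintegral_enorm_convolution_sub_le (integrable_heatKernel d ht) hmi
      (continuous_heatKernel d t).measurable hm)
  rw [integral_heatKernel d ht, one_mul,
    ← integral_sub_left_eq_self (fun y => heatKernel d t (x - y) * m y) volume x]
  simp only [sub_sub_cancel, mul_comm]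

theorem tendsto_lintegral_convolution_heatKernel_sub_atTop {d : ℕ}
    {m : EuclideanSpace ℝ (Fin d) → ℝ} (hmi : Integrable m) (hm : Measurable m) :
    Tendsto (fun t => ∫⁻ x, ‖(∫ y, heatKernel d t (x - y) * m y) -
      (∫ y, m y) * heatKernel d t x‖ₑ) atTop (𝓝 0) := by
  have hr : Tendsto (fun t : ℝ => (√t)⁻¹) atTop (𝓝 0) :=
    tendsto_inv_atTop_zero.comp Real.tendsto_sqrt_atTop
  refine tendsto_of_tendsto_of_tendsto_of_le_of_le' tendsto_const_nhds
    (tendsto_lintegral_mul_translationModulus hmi hm (integrable_heatKernel d one_pos)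
      (continuous_heatKernel d 1).measurable hr) (Eventually.of_forall fun _ => zero_le) ?_
  filter_upwards [eventually_gt_atTop 0] with t ht
  simp_rw [← translationModulus_heatKernel ht]
  exact lintegral_enorm_convolution_sub_le hmi (integrable_heatKernel d ht) hm
    (continuous_heatKernel d t).measurable

theorem measurable_integral_heatKernel_mul {d : ℕ} {m : EuclideanSpace ℝ (Fin d) → ℝ}
    (hm : Measurable m) (t : ℝ) : Measurable fun x => ∫ y, heatKernel d t (x - y) * m y := by
  have hc := continuous_heatKernel d t
  have h : Measurable fun q : EuclideanSpace ℝ (Fin d) × EuclideanSpace ℝ (Fin d) =>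
      heatKernel d t (q.1 - q.2) * m q.2 := by fun_prop
  exact h.stronglyMeasurable.integral_prod_right.measurable

/-- Gaussian decay of the heat evolution of a compactly supported datum. -/
theorem integral_heatKernel_mul_le {d : ℕ} {m : EuclideanSpace ℝ (Fin d) → ℝ}
    (hmi : Integrable m) (hm0 : ∀ x, 0 ≤ m x) {R : ℝ} (hR : ∀ x, m x ≠ 0 → ‖x‖ ≤ R)
    {t : ℝ} (ht : 0 < t) (x : EuclideanSpace ℝ (Fin d)) :
    ∫ y, heatKernel d t (x - y) * m y ≤
      t ^ (-(d : ℝ) / 2) * Real.exp (π * R ^ 2 / t) * (∫ y, m y) *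
        Real.exp (-(π / (2 * t)) * ‖x‖ ^ 2) := by
  calc ∫ y, heatKernel d t (x - y) * m y
      ≤ ∫ y, t ^ (-(d : ℝ) / 2) * Real.exp (π * R ^ 2 / t) *
          Real.exp (-(π / (2 * t)) * ‖x‖ ^ 2) * m y := by
        refine integral_mono_of_nonneg
          (ae_of_all _ fun y => mul_nonneg (heatKernel_nonneg d ht _) (hm0 y))
          (hmi.const_mul _) (ae_of_all _ fun y => ?_)
        by_cases hy : m y = 0
        · simp [hy]
        refine mul_le_mul_of_nonneg_right ?_ (hm0 y)
        rw [heatKernel, mul_assoc, ← Real.exp_add]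
        gcongr
        have hyR : ‖y‖ ^ 2 ≤ R ^ 2 := by
          have := hR y hy
          gcongr
        have hpar : ‖x‖ ^ 2 ≤ 2 * ‖x - y‖ ^ 2 + 2 * ‖y‖ ^ 2 := by
          have h1 : ‖x‖ ≤ ‖x - y‖ + ‖y‖ := by simpa using norm_add_le (x - y) y
          nlinarith [sq_nonneg (‖x - y‖ - ‖y‖), norm_nonneg x]
        have hdiff : π * R ^ 2 / t + -(π / (2 * t)) * ‖x‖ ^ 2 - -π * ‖x - y‖ ^ 2 / t =
            π / (2 * t) * (2 * R ^ 2 - ‖x‖ ^ 2 + 2 * ‖x - y‖ ^ 2) := by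
          field_simp
          ring
        have : 0 ≤ π / (2 * t) * (2 * R ^ 2 - ‖x‖ ^ 2 + 2 * ‖x - y‖ ^ 2) :=
          mul_nonneg (by positivity) (by linarith)
        linarith
    _ = _ := by
        rw [integral_const_mul]
        ring

theorem integrable_rexp_neg_mul_sq_norm {E : Type*} [NormedAddCommGroup E]
    [InnerProductSpace ℝ E] [FiniteDimensional ℝ E] [MeasurableSpace E] [BorelSpace E]
    {b : ℝ} (hb : 0 < b) : Integrable fun v : E => Real.exp (-b * ‖v‖ ^ 2) := by
  refine (integrable_cexp_neg_mul_sq_norm (E := E) hb).norm.congr (ae_of_all _ fun x => ?_)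
  simp only [Complex.norm_exp]
  norm_cast

theorem integrable_rpow_of_le_gaussian {E : Type*} [NormedAddCommGroup E]
    [InnerProductSpace ℝ E] [FiniteDimensional ℝ E] [MeasurableSpace E] [BorelSpace E]
    {u : E → ℝ} (hu : Measurable u) (hu0 : ∀ x, 0 ≤ u x) {A b s : ℝ} (hA : 0 ≤ A) (hb : 0 < b)
    (hs : 0 < s) (hle : ∀ x, u x ≤ A * Real.exp (-b * ‖x‖ ^ 2)) :
    Integrable fun x => ((u x ^ s : ℝ) : ℂ) := by
  suffices h : Integrable fun x => u x ^ s from h.ofReal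
  refine ((integrable_rexp_neg_mul_sq_norm (E := E) (b := b * s)
    (by positivity)).const_mul (A ^ s)).mono' (hu.pow_const s).aestronglyMeasurable (ae_of_all _ fun x => ?_)
  rw [Real.norm_of_nonneg (Real.rpow_nonneg (hu0 x) s)]
  refine (Real.rpow_le_rpow (hu0 x) (hle x) hs.le).trans_eq ?_
  rw [Real.mul_rpow hA (Real.exp_nonneg _), ← Real.exp_mul]
  ring_nf

theorem fourier_heatKernel_rpow (d : ℕ) {p t : ℝ} (ht : 0 < t)
    (ξ : EuclideanSpace ℝ (Fin d)) :
    𝓕 (fun x => ((heatKernel d t x ^ (1 / p) : ℝ) : ℂ)) ξ =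
      ((t ^ ((d : ℝ) / 2 * (1 - 1 / p)) : ℝ) : ℂ) *
        𝓕 (fun x => ((heatKernel d 1 x ^ (1 / p) : ℝ) : ℂ)) (√t • ξ) := by
  have hs : 0 < √t := Real.sqrt_pos.2 ht
  have hpow : √t ^ d = t ^ ((d : ℝ) / 2) := by
    rw [Real.sqrt_eq_rpow, ← Real.rpow_natCast, ← Real.rpow_mul ht.le]
    ring_nf
  have hpos : 0 < t ^ ((d : ℝ) / 2) := by positivity
  have h := Measure.integral_comp_smul (volume : Measure (EuclideanSpace ℝ (Fin d)))
    (fun x => 𝐞 (-inner ℝ x ξ) • ((heatKernel d t x ^ (1 / p) : ℝ) : ℂ)) (√t)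
  rw [finrank_euclideanSpace_fin, hpow, abs_of_pos (by positivity), eq_inv_smul_iff₀ hpos.ne'] at h
  rw [Real.fourier_eq, Real.fourier_eq, ← h, ← integral_smul, ← integral_const_mul]
  refine integral_congr_ae (ae_of_all _ fun x => ?_)
  have hexp : t ^ ((d : ℝ) / 2) * (t ^ (-(d : ℝ) / 2)) ^ (1 / p) =
      t ^ ((d : ℝ) / 2 * (1 - 1 / p)) := by
    rw [← Real.rpow_mul ht.le, ← Real.rpow_add ht]
    ring_nf
  simp only [real_inner_smul_left, real_inner_smul_right]
  rw [heatKernel_sqrt_smul d ht, Real.mul_rpow (by positivity) (heatKernel_nonneg d one_pos x),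
    ← hexp, Circle.smul_def, Circle.smul_def, Complex.real_smul]
  push_cast
  simp only [smul_eq_mul]
  ring

theorem eLpNorm_fourier_heatKernel_rpow (d : ℕ) {p q t : ℝ} (hq : 0 < q)
    (hpq : (1 - 1 / p) * q = 1) (ht : 0 < t) :
    eLpNorm (𝓕 fun x => ((heatKernel d t x ^ (1 / p) : ℝ) : ℂ)) (ENNReal.ofReal q) volume =
      eLpNorm (𝓕 fun x => ((heatKernel d 1 x ^ (1 / p) : ℝ) : ℂ)) (ENNReal.ofReal q) volume := by
  rw [eLpNorm_eq_lintegral_rpow_enorm_toReal (by simpa using hq) ENNReal.ofReal_ne_top,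
    eLpNorm_eq_lintegral_rpow_enorm_toReal (by simpa using hq) ENNReal.ofReal_ne_top,
    ENNReal.toReal_ofReal hq.le]
  congr 1
  rw [lintegral_eq_mul_lintegral_comp_sqrt_smul ht (fun ξ =>
      ‖𝓕 (fun x => ((heatKernel d 1 x ^ (1 / p) : ℝ) : ℂ)) ξ‖ₑ ^ q),
    ← lintegral_const_mul' _ _ ENNReal.ofReal_ne_top]
  refine lintegral_congr fun ξ => ?_
  rw [fourier_heatKernel_rpow d ht, enorm_mul, ENNReal.mul_rpow_of_nonneg _ _ hq.le,
    ← ofReal_norm (((t ^ ((d : ℝ) / 2 * (1 - 1 / p)) : ℝ) : ℂ)), Complex.norm_real,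
    Real.norm_of_nonneg (by positivity), ENNReal.ofReal_rpow_of_nonneg (by positivity) hq.le,
    ← Real.rpow_mul ht.le, mul_assoc, hpq, mul_one]

theorem integrable_of_bounded_of_hasCompactSupport {X F : Type*} [TopologicalSpace X]
    [R1Space X] [MeasurableSpace X] [BorelSpace X] {μ : Measure X} [IsFiniteMeasureOnCompacts μ]
    [NormedAddCommGroup F] {h : X → F} (hm : AEStronglyMeasurable h μ) {C : ℝ}
    (hb : ∀ x, ‖h x‖ ≤ C) (hs : HasCompactSupport h) : Integrable h μ := by
  rw [← integrableOn_iff_integrable_of_support_subset (subset_tsupport h)]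
  exact IntegrableOn.of_bound hs.measure_lt_top hm.restrict C (ae_of_all _ hb)

theorem toReal_eLpNorm_eq_integral_rpow {X F : Type*} [MeasurableSpace X] {μ : Measure X}
    [NormedAddCommGroup F] {f : X → F} {p : ℝ} (hp : 0 < p) (hf : AEStronglyMeasurable f μ) :
    (eLpNorm f (ENNReal.ofReal p) μ).toReal = (∫ x, ‖f x‖ ^ p ∂μ) ^ (1 / p) := by
  rw [eLpNorm_eq_lintegral_rpow_enorm_toReal (by simpa using hp) ENNReal.ofReal_ne_top,
    ENNReal.toReal_ofReal hp.le, ← ENNReal.toReal_rpow,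
    integral_eq_lintegral_of_nonneg_ae (ae_of_all _ fun x => by positivity)
      (hf.norm.aemeasurable.pow_const p).aestronglyMeasurable]
  simp_rw [← ENNReal.ofReal_rpow_of_nonneg (norm_nonneg _) hp.le, ofReal_norm]

theorem integrable_heatKernel_rpow (d : ℕ) {s t : ℝ} (hs : 0 < s) (ht : 0 < t) :
    Integrable fun x => ((heatKernel d t x ^ s : ℝ) : ℂ) :=
  integrable_rpow_of_le_gaussian (continuous_heatKernel d t).measurable
    (heatKernel_nonneg d ht) (A := t ^ (-(d : ℝ) / 2)) (b := π / t) (by positivity)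
    (by positivity) hs fun x => (heatKernel_eq_const_mul d t x).le

theorem integrable_integral_heatKernel_mul_rpow {d : ℕ} {m : EuclideanSpace ℝ (Fin d) → ℝ}
    (hmi : Integrable m) (hm : Measurable m) (hm0 : ∀ x, 0 ≤ m x) {R : ℝ}
    (hR : ∀ x, m x ≠ 0 → ‖x‖ ≤ R) {s t : ℝ} (hs : 0 < s) (ht : 0 < t) :
    Integrable fun x => (((∫ y, heatKernel d t (x - y) * m y) ^ s : ℝ) : ℂ) :=
  integrable_rpow_of_le_gaussian (measurable_integral_heatKernel_mul hm t)
    (fun x => integral_nonneg fun y => mul_nonneg (heatKernel_nonneg d ht _) (hm0 y))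
    (mul_nonneg (by positivity) (integral_nonneg hm0)) (by positivity) hs
    (integral_heatKernel_mul_le hmi hm0 hR ht)

theorem tendsto_rpow_nhds_zero {α : Type*} {l : Filter α} {u : α → ℝ≥0∞} {s : ℝ} (hs : 0 < s)
    (hu : Tendsto u l (𝓝 0)) : Tendsto (fun a => u a ^ s) l (𝓝 0) := by
  have h := (ENNReal.continuous_rpow_const (y := s)).tendsto 0 |>.comp hu
  rwa [ENNReal.zero_rpow_of_pos hs] at h

/-- for `p ∈ (1,2]` with `p'` an even integer and `f` bounded with compact
support, setting `dμ = |f|^p dx`, `q = p'`, one has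
`lim_{t→0} Q_{p,q}(t) = ‖(|f|)^∧‖_{p'}`, `lim_{t→∞} Q_{p,q}(t) = ‖(H₁^{1/p})^∧‖_{p'} ‖f‖_p`,
and consequently the sharp Hausdorff--Young inequality
`‖f̂‖_{p'} ≤ (p^{1/p}/p'^{1/p'})^{d/2} ‖f‖_p`. -/
theorem statement16 (d : ℕ) (hd : 0 < d) (p : ℝ) (hp1 : 1 < p) (hp2 : p ≤ 2)
    (hpeven : ∃ k : ℕ, p / (p - 1) = 2 * k)
    (f : EuclideanSpace ℝ (Fin d) → ℂ) (hmeas : Measurable f)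
    (hbdd : ∃ C : ℝ, ∀ x, ‖f x‖ ≤ C) (hsupp : HasCompactSupport f) :
    Tendsto
        (Q d (volume.withDensity fun x => ENNReal.ofReal (‖f x‖ ^ p)) p (p / (p - 1)))
        (𝓝[>] 0)
        (𝓝 ((eLpNorm (𝓕 fun x => ((‖f x‖ : ℝ) : ℂ))
          (ENNReal.ofReal (p / (p - 1))) volume).toReal) ) ∧
      Tendsto
        (Q d (volume.withDensity fun x => ENNReal.ofReal (‖f x‖ ^ p)) p (p / (p - 1)))
        atTop
        (𝓝 ((eLpNorm (𝓕 fun x => ((heatKernel d 1 x ^ (1 / p) : ℝ) : ℂ))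
            (ENNReal.ofReal (p / (p - 1))) volume).toReal *
          (eLpNorm f (ENNReal.ofReal p) volume).toReal)) ∧
      (eLpNorm (𝓕 f) (ENNReal.ofReal (p / (p - 1))) volume).toReal ≤
        (p ^ (1 / p) / (p / (p - 1)) ^ (1 - 1 / p)) ^ ((d : ℝ) / 2) *
          (eLpNorm f (ENNReal.ofReal p) volume).toReal := by
  have hp0 : 0 < p := by positivity
  have hp1' : 0 < p - 1 := by linarith
  have hq0 : 0 < p / (p - 1) := by positivity
  obtain ⟨n, hn⟩ : ∃ n : ℕ, p / (p - 1) = 2 * (n + 1) := by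
    obtain ⟨k, hk⟩ := hpeven
    cases k with
    | zero => simp [hk] at hq0
    | succ n => exact ⟨n, by exact_mod_cast hk⟩
  have hq1 : 1 ≤ ENNReal.ofReal (p / (p - 1)) := by
    rw [ENNReal.one_le_ofReal, one_le_div hp1']
    linarith
  have hpq : (1 - 1 / p) * (p / (p - 1)) = 1 := by field_simp
  obtain ⟨C, hC⟩ := hbdd
  obtain ⟨R, hR⟩ := hsupp.isBounded.exists_norm_le
  have hHY : ∀ g : EuclideanSpace ℝ (Fin d) → ℂ, Integrable g → Measurable g →
      eLpNorm (𝓕 g) (ENNReal.ofReal (p / (p - 1))) volume ≤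
        ENNReal.ofReal ((p ^ (1 / p) / (p / (p - 1)) ^ (1 - 1 / p)) ^ ((d : ℝ) / 2)) *
          eLpNorm g (ENNReal.ofReal p) volume := fun g => eLpNorm_fourier_le hp1 hn
  have hHYfin : ∀ g : EuclideanSpace ℝ (Fin d) → ℂ, Integrable g → Measurable g →
      eLpNorm g (ENNReal.ofReal p) volume ≠ ⊤ →
      eLpNorm (𝓕 g) (ENNReal.ofReal (p / (p - 1))) volume ≠ ⊤ := fun g hg hgm hgp =>
    ne_top_of_le_ne_top (ENNReal.mul_ne_top ENNReal.ofReal_ne_top hgp) (hHY g hg hgm)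
  have hfi : Integrable f :=
    integrable_of_bounded_of_hasCompactSupport hmeas.aestronglyMeasurable hC hsupp
  set m : EuclideanSpace ℝ (Fin d) → ℝ := fun x => ‖f x‖ ^ p with hmdef
  have hm : Measurable m := by fun_prop
  have hm0 : ∀ x, 0 ≤ m x := fun x => by positivity
  have hmC : ∀ x, ‖m x‖ ≤ C ^ p := fun x => by
    rw [Real.norm_of_nonneg (hm0 x)]
    exact Real.rpow_le_rpow (norm_nonneg _) (hC x) hp0.le
  have hmf : ∀ x, m x ≠ 0 → f x ≠ 0 := fun x hx h => hx (by simp [hmdef, h, hp0.ne'])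
  have hmi : Integrable m := integrable_of_bounded_of_hasCompactSupport
    hm.aestronglyMeasurable hmC (hsupp.mono fun x hx => hmf x hx)
  have hmR : ∀ x, m x ≠ 0 → ‖x‖ ≤ R := fun x hx => hR x (subset_tsupport f (hmf x hx))
  have hmroot : ∀ x, m x ^ (1 / p) = ‖f x‖ := fun x => by
    rw [hmdef, ← Real.rpow_mul (norm_nonneg _), mul_one_div_cancel hp0.ne', Real.rpow_one]
  have hfp : eLpNorm f (ENNReal.ofReal p) volume ≠ ⊤ := by
    refine ((integrable_norm_rpow_iff hmeas.aestronglyMeasurable (by simpa using hp0)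
      ENNReal.ofReal_ne_top).1 ?_).2.ne
    rwa [ENNReal.toReal_ofReal hp0.le]
  have hs : 0 < 1 / p := by positivity
  set u : ℝ → EuclideanSpace ℝ (Fin d) → ℝ := fun t x => ∫ y, heatKernel d t (x - y) * m y
    with hu
  have hQ : ∀ t, Q d (volume.withDensity fun x => ENNReal.ofReal (‖f x‖ ^ p)) p (p / (p - 1)) t =
      (eLpNorm (𝓕 fun x => ((u t x ^ (1 / p) : ℝ) : ℂ))
        (ENNReal.ofReal (p / (p - 1))) volume).toReal := by
    intro t
    have h0 : 1 / (p / (p - 1)) - (1 - 1 / p) = 0 := by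
      field_simp
      ring
    have hev : heatEvolution d (volume.withDensity fun x => ENNReal.ofReal (‖f x‖ ^ p)) t = u t :=
      funext (heatEvolution_withDensity hm hm0 t)
    rw [Q, h0, mul_zero, Real.rpow_zero, one_mul, hev]
  have hum : ∀ t, Measurable (u t) := measurable_integral_heatKernel_mul hm
  have hu0 : ∀ {t}, 0 < t → ∀ x, 0 ≤ u t x := fun ht x =>
    integral_nonneg fun y => mul_nonneg (heatKernel_nonneg d ht _) (hm0 y)
  have hui : ∀ {t}, 0 < t → Integrable fun x => ((u t x ^ (1 / p) : ℝ) : ℂ) := fun ht =>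
    integrable_integral_heatKernel_mul_rpow hmi hm hm0 hmR hs ht
  have humc : ∀ t, Measurable fun x => ((u t x ^ (1 / p) : ℝ) : ℂ) := fun t => by
    have := hum t
    fun_prop
  refine ⟨?_, ?_, ?_⟩
  · simp_rw [funext hQ, ← hmroot]
    have hgi : Integrable fun x => ((m x ^ (1 / p) : ℝ) : ℂ) := by
      simp_rw [hmroot]
      exact hfi.norm.ofReal
    have hgm : Measurable fun x => ((m x ^ (1 / p) : ℝ) : ℂ) := by fun_prop
    have hgp : eLpNorm (fun x => ((m x ^ (1 / p) : ℝ) : ℂ)) (ENNReal.ofReal p) volume ≠ ⊤ := by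
      simp_rw [hmroot]
      rwa [eLpNorm_congr_norm_ae (g := f) (ae_of_all _ fun x => by simp)]
    have hpos : ∀ᶠ t : ℝ in 𝓝[>] 0, 0 < t := self_mem_nhdsWithin
    refine tendsto_eLpNorm_fourier hq1 ENNReal.ofReal_ne_top (hHYfin _ hgi hgm hgp) hHY
      (g := fun _ x => ((m x ^ (1 / p) : ℝ) : ℂ)) (hpos.mono fun t ht => hui ht)
      (Eventually.of_forall humc) (Eventually.of_forall fun _ => hgi)
      (Eventually.of_forall fun _ => hgm) (Eventually.of_forall fun _ => rfl) ?_
    refine tendsto_of_tendsto_of_tendsto_of_le_of_le' tendsto_const_nhds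
      (tendsto_rpow_nhds_zero hs (tendsto_lintegral_convolution_heatKernel_sub_zero hmi hm))
      (Eventually.of_forall fun _ => zero_le) (hpos.mono fun t ht => ?_)
    exact eLpNorm_rpow_sub_rpow_le hp1.le (hu0 ht) hm0
  · rw [funext hQ, toReal_eLpNorm_eq_integral_rpow hp0 hmeas.aestronglyMeasurable, mul_comm]
    set M := ∫ x, ‖f x‖ ^ p with hM
    have hM0 : 0 ≤ M := integral_nonneg hm0
    set v : ℝ → EuclideanSpace ℝ (Fin d) → ℝ := fun t x => M * heatKernel d t x with hv
    have hv0 : ∀ {t}, 0 < t → ∀ x, 0 ≤ v t x := fun ht x =>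
      mul_nonneg hM0 (heatKernel_nonneg d ht x)
    have hvroot : ∀ {t}, 0 < t → (fun x => ((v t x ^ (1 / p) : ℝ) : ℂ)) =
        ((M ^ (1 / p) : ℝ) : ℂ) • fun x => ((heatKernel d t x ^ (1 / p) : ℝ) : ℂ) := by
      intro t ht
      ext x
      rw [hv, Real.mul_rpow hM0 (heatKernel_nonneg d ht x)]
      simp
    have hHi : ∀ {t}, 0 < t → Integrable fun x => ((heatKernel d t x ^ (1 / p) : ℝ) : ℂ) :=
      integrable_heatKernel_rpow d hs
    have hHm : Measurable fun x => ((heatKernel d 1 x ^ (1 / p) : ℝ) : ℂ) := by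
      have := (continuous_heatKernel d 1).measurable
      fun_prop
    have hHp : eLpNorm (fun x => ((heatKernel d 1 x ^ (1 / p) : ℝ) : ℂ))
        (ENNReal.ofReal p) volume ≠ ⊤ := by
      refine ((integrable_norm_rpow_iff hHm.aestronglyMeasurable (by simpa using hp0)
        ENNReal.ofReal_ne_top).1 ((integrable_heatKernel d one_pos).congr
          (ae_of_all _ fun x => ?_))).2.ne
      have hx := heatKernel_nonneg d one_pos x
      simp only [ENNReal.toReal_ofReal hp0.le, Complex.norm_real]
      rw [Real.norm_of_nonneg (by positivity), ← Real.rpow_mul hx, one_div_mul_cancel hp0.ne',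
        Real.rpow_one]
    have hFH : ∀ {t}, 0 < t → eLpNorm (𝓕 fun x => ((v t x ^ (1 / p) : ℝ) : ℂ))
        (ENNReal.ofReal (p / (p - 1))) volume = ENNReal.ofReal (M ^ (1 / p)) *
          eLpNorm (𝓕 fun x => ((heatKernel d 1 x ^ (1 / p) : ℝ) : ℂ))
            (ENNReal.ofReal (p / (p - 1))) volume := by
      intro t ht
      have hF : 𝓕 (((M ^ (1 / p) : ℝ) : ℂ) • fun x => ((heatKernel d t x ^ (1 / p) : ℝ) : ℂ)) =
          ((M ^ (1 / p) : ℝ) : ℂ) • 𝓕 fun x => ((heatKernel d t x ^ (1 / p) : ℝ) : ℂ) :=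
        VectorFourier.fourierIntegral_const_smul _ _ _ _ _
      rw [hvroot ht, hF, eLpNorm_const_smul, eLpNorm_fourier_heatKernel_rpow d hq0 hpq ht,
        ← ofReal_norm, Complex.norm_real, Real.norm_of_nonneg (by positivity)]
    rw [← ENNReal.toReal_ofReal (Real.rpow_nonneg hM0 (1 / p)), ← ENNReal.toReal_mul]
    have hpos := eventually_gt_atTop (0 : ℝ)
    refine tendsto_eLpNorm_fourier hq1 ENNReal.ofReal_ne_top
      (ENNReal.mul_ne_top ENNReal.ofReal_ne_top (hHYfin _ (hHi one_pos) hHm hHp)) hHY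
      (g := fun t x => ((v t x ^ (1 / p) : ℝ) : ℂ)) (hpos.mono fun t ht => hui ht)
      (Eventually.of_forall humc) (hpos.mono fun t ht => ?_)
      (Eventually.of_forall fun t => ?_) (hpos.mono fun t ht => hFH ht) ?_
    · rw [hvroot ht]
      exact (hHi ht).smul _
    · have := (continuous_heatKernel d t).measurable
      fun_prop
    refine tendsto_of_tendsto_of_tendsto_of_le_of_le' tendsto_const_nhds
      (tendsto_rpow_nhds_zero hs (tendsto_lintegral_convolution_heatKernel_sub_atTop hmi hm))
      (Eventually.of_forall fun _ => zero_le) (hpos.mono fun t ht => ?_)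
    exact eLpNorm_rpow_sub_rpow_le hp1.le (hu0 ht) (hv0 ht)
  · have h := ENNReal.toReal_mono (ENNReal.mul_ne_top ENNReal.ofReal_ne_top hfp)
      (hHY f hfi hmeas)
    rwa [ENNReal.toReal_mul, ENNReal.toReal_ofReal (by positivity)] at h
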